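/- arXiv:1405.0630 — 7 statements merged into one kernel-verified Lean document; each statement's English description precedes it below -/
import Mathlib

section
/- Let k be a field of characteristic zero, K = k(t), and let γ, c ∈ k[t] with φ(x) = (x−γ)² + c. Assume φ is stable, post-critically infinite, h(γ) = h(c), and γ − c is non-constant (h(γ−c) ≠ 0). Then for every integer n > 2·log₂(78·h(γ)/h(γ−c)) + 9, the extension K_n/K_{n−1} is maximal, i.e. the splitting field of φ^n over K_{n−1} has degree 2^(2^(n−1)) over K_{n−1}. -/
open Polynomial

theorem isSquare_powerSeries_of_isUnit {F : Type*} [Field F] [CharZero F] [IsAlgClosed F]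
    {u : PowerSeries F} (hu : IsUnit u) : IsSquare u := by
  obtain ⟨r, hr⟩ := IsAlgClosed.exists_pow_nat_eq (PowerSeries.constantCoeff u) two_pos
  have hr0 : r ≠ 0 := by
    rintro rfl
    have := (PowerSeries.isUnit_iff_constantCoeff.mp hu).ne_zero
    simp_all
  obtain ⟨a, ha, -⟩ := HenselianRing.is_henselian
    (I := Ideal.span {(PowerSeries.X : PowerSeries F)}) (X ^ 2 - C u)
    (monic_X_pow_sub_C u two_ne_zero) (PowerSeries.C r)
    (by rw [Ideal.mem_span_singleton, PowerSeries.X_dvd_iff]; simp [hr])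
    (by
      apply IsUnit.map
      rw [PowerSeries.isUnit_iff_constantCoeff]
      simp [hr0])
  exact ⟨a, by rw [IsRoot, eval_sub, eval_pow, eval_X, eval_C, sub_eq_zero] at ha; rw [← ha, sq]⟩

/-- The `n`-th iterate under composition of the polynomial `(x - g)² + c`. -/
noncomputable def quadIter {R : Type*} [CommRing R] (g c : R) (n : ℕ) : R[X] :=
  (fun p => p.comp ((X - C g) ^ 2 + C c))^[n] X

section quadIter

variable {R S : Type*} [CommRing R] [CommRing S] (g c : R)

theorem quadIter_zero : quadIter g c 0 = X := rfl

theorem quadIter_succ (n : ℕ) :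
    quadIter g c (n + 1) = (quadIter g c n).comp ((X - C g) ^ 2 + C c) :=
  Function.iterate_succ_apply' _ _ _

theorem quadIter_map (f : R →+* S) (n : ℕ) :
    (quadIter g c n).map f = quadIter (f g) (f c) n := by
  induction n with
  | zero => simp [quadIter_zero]
  | succ n ih => simp [quadIter_succ, map_comp, ih]

theorem eval_quadIter (n : ℕ) (a : R) :
    (quadIter g c n).eval a = (fun a => (a - g) ^ 2 + c)^[n] a := by
  induction n generalizing a with
  | zero => simp [quadIter_zero]
  | succ n ih => simp [quadIter_succ, ih]

theorem map_iterate_sub_sq_add (f : R →+* S) (n : ℕ) (a : R) :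
    f ((fun a => (a - g) ^ 2 + c)^[n] a) = (fun a => (a - f g) ^ 2 + f c)^[n] (f a) := by
  rw [← eval_quadIter, ← eval_quadIter, ← quadIter_map, eval_map, eval₂_at_apply]

theorem natDegree_sq_add [Nontrivial R] : ((X - C g) ^ 2 + C c).natDegree = 2 := by
  compute_degree!

theorem monic_sq_add [Nontrivial R] : ((X - C g) ^ 2 + C c).Monic := by
  monicity!

theorem quadIter_monic [IsDomain R] (n : ℕ) : (quadIter g c n).Monic := by
  induction n with
  | zero => exact monic_X
  | succ n ih =>
    rw [quadIter_succ]
    exact ih.comp (monic_sq_add g c) (by simp)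

theorem natDegree_quadIter [IsDomain R] (n : ℕ) : (quadIter g c n).natDegree = 2 ^ n := by
  induction n with
  | zero => simp [quadIter_zero]
  | succ n ih => rw [quadIter_succ, natDegree_comp, ih, natDegree_sq_add, pow_succ]

/-- Iterates of `(x - g)² + c` split as long as the critical orbit consists of units. -/
theorem splits_quadIter [IsDomain R] (hsq : ∀ u : R, IsUnit u → IsSquare u) (n : ℕ)
    (hu : ∀ m, 1 ≤ m → m ≤ n → IsUnit ((fun a => (a - g) ^ 2 + c)^[m] g)) :
    (quadIter g c n).Splits := by
  induction n with
  | zero => exact Splits.X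
  | succ n ih =>
    have hs := ih fun m h1 h2 => hu m h1 (by omega)
    have hprod := hs.eq_prod_roots_of_monic (quadIter_monic g c n)
    have hn := hu (n + 1) (by omega) le_rfl
    rw [← eval_quadIter, quadIter_succ, hprod, multiset_prod_comp, eval_multiset_prod] at hn
    rw [quadIter_succ, hprod, multiset_prod_comp]
    refine Splits.multisetProd fun f hf => ?_
    simp only [Multiset.map_map, Multiset.mem_map, Function.comp_apply] at hf
    obtain ⟨α, hα, rfl⟩ := hf
    have hunit : IsUnit (c - α) := by
      refine isUnit_of_dvd_unit ?_ hn
      refine Multiset.dvd_prod ?_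
      simp only [Multiset.map_map, Multiset.mem_map, Function.comp_apply]
      exact ⟨α, hα, by simp⟩
    obtain ⟨r, hr⟩ := hsq (α - c) (by rw [← neg_sub]; exact hunit.neg)
    have : (X - C α).comp ((X - C g) ^ 2 + C c) = (X - C (g + r)) * (X - C (g - r)) := by
      have hr' := congrArg (C : R →+* R[X]) hr
      simp only [map_sub, map_mul] at hr'
      simp only [sub_comp, X_comp, C_comp, map_add, map_sub]
      linear_combination -hr'
    rw [this]
    exact (Splits.X_sub_C _).mul (Splits.X_sub_C _)

end quadIter

theorem even_rootMultiplicity_of_isSquare {k F : Type*} [Field k] [CharZero k] [Field F]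
    [Algebra k F] [IsAlgClosed F] (γ c : k[X]) (n : ℕ) (θ : F)
    (hθ : ∀ m, 1 ≤ m → m ≤ n →
      (((fun a => (a - γ) ^ 2 + c)^[m] γ).map (algebraMap k F)).eval θ ≠ 0)
    (b : k[X]) (hb0 : b ≠ 0)
    (P : (RatFunc k)[X]) (hP : P = quadIter (algebraMap k[X] (RatFunc k) γ)
      (algebraMap k[X] (RatFunc k) c) n)
    (hb : IsSquare (algebraMap (RatFunc k) P.SplittingField (algebraMap k[X] (RatFunc k) b))) :
    Even ((b.map (algebraMap k F)).rootMultiplicity θ) := by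
  have : CharZero F := charZero_of_injective_algebraMap (algebraMap k F).injective
  let τ : F[X] →+* PowerSeries F := (coeToPowerSeries.ringHom).comp (taylorAlgHom θ).toRingHom
  have hτ (p : F[X]) : τ p = (taylor θ p : F[X]) := rfl
  have hτu (p : F[X]) (hp : p.eval θ ≠ 0) : IsUnit (τ p) := by
    rw [PowerSeries.isUnit_iff_constantCoeff, hτ]
    simpa [taylor_coeff_zero] using hp
  let ι : k[X] →+* PowerSeries F := τ.comp (mapRingHom (algebraMap k F))
  have hι (p : k[X]) : ι p = τ (p.map (algebraMap k F)) := rfl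
  let A := FractionRing (PowerSeries F)
  let j : k[X] →+* A := (algebraMap (PowerSeries F) A).comp ι
  have hj : Function.Injective j := by
    refine (IsFractionRing.injective (PowerSeries F) A).comp ?_
    refine Function.Injective.comp ?_ (map_injective _ (algebraMap k F).injective)
    exact (Polynomial.coe_injective F).comp (taylor_injective θ)
  let J : RatFunc k →+* A := IsFractionRing.lift hj
  have hJ (p : k[X]) : J (algebraMap k[X] (RatFunc k) p) = algebraMap (PowerSeries F) A (ι p) :=
    IsFractionRing.lift_algebraMap hj p
  have hs : (P.map J).Splits := by
    rw [hP, quadIter_map, hJ, hJ, ← quadIter_map]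
    refine Splits.map (splits_quadIter _ _ (fun u => isSquare_powerSeries_of_isUnit) n ?_) _
    intro m h1 h2
    rw [← map_iterate_sub_sq_add γ c ι]
    exact hτu _ (hθ m h1 h2)
  let _ : Algebra (RatFunc k) A := J.toAlgebra
  let Ψ : P.SplittingField →ₐ[RatFunc k] A := SplittingField.lift P hs
  obtain ⟨w, hw⟩ : IsSquare (algebraMap (PowerSeries F) A (ι b)) := by
    rw [← hJ]
    have := hb.map Ψ
    rwa [AlgHom.commutes] at this
  have hint : IsIntegral (PowerSeries F) w := by
    refine IsIntegral.of_pow (n := 2) two_pos ?_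
    rw [sq, ← hw]
    exact isIntegral_algebraMap
  obtain ⟨v, rfl⟩ := IsIntegrallyClosed.isIntegral_iff.mp hint
  rw [← map_mul] at hw
  have hv : ι b = v * v := IsFractionRing.injective (PowerSeries F) A hw
  have hbF : b.map (algebraMap k F) ≠ 0 :=
    (Polynomial.map_ne_zero_iff (algebraMap k F).injective).mpr hb0
  obtain ⟨q, hq, hqθ⟩ := exists_eq_pow_rootMultiplicity_mul_and_not_dvd _ hbF θ
  set r := (b.map (algebraMap k F)).rootMultiplicity θ
  have hX : τ (X - C θ) = PowerSeries.X := by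
    rw [hτ, map_sub, taylor_X, taylor_C]; simp
  rw [hι, hq, map_mul, map_pow, hX] at hv
  have hord := congrArg PowerSeries.order hv
  rw [PowerSeries.order_mul, PowerSeries.order_mul, PowerSeries.order_X_pow,
    PowerSeries.order_zero_of_unit (hτu q (by rwa [dvd_iff_isRoot] at hqθ))] at hord
  have hfin : v.order ≠ ⊤ := by
    intro h; rw [h] at hord; simp at hord
  obtain ⟨a, ha⟩ := ENat.ne_top_iff_exists.mp hfin
  rw [← ha] at hord
  exact ⟨a, by exact_mod_cast hord⟩

open IntermediateField in
theorem mem_adjoin_sqrt {L M : Type*} [Field L] [Field M] [Algebra L M] {β w : M} {e : L}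
    (hβ : β ^ 2 = algebraMap L M e) (hw : w ∈ L⟮β⟯) :
    ∃ u v : L, w = algebraMap L M u + algebraMap L M v * β := by
  have hint : IsIntegral L β := by
    refine IsIntegral.of_pow (n := 2) two_pos ?_
    rw [hβ]
    exact isIntegral_algebraMap
  rw [← mem_toSubalgebra, adjoin_simple_toSubalgebra_of_isAlgebraic hint.isAlgebraic,
    Algebra.adjoin_singleton_eq_range_aeval] at hw
  obtain ⟨p, rfl⟩ := hw
  have hm : (X ^ 2 - C e).Monic := monic_X_pow_sub_C e two_ne_zero
  have hd : (p %ₘ (X ^ 2 - C e)).natDegree ≤ 1 := by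
    have := natDegree_modByMonic_lt p hm (by
      intro h
      have := congrArg natDegree h
      rw [natDegree_X_pow_sub_C] at this
      simp at this)
    rw [natDegree_X_pow_sub_C] at this
    omega
  obtain ⟨v, u, huv⟩ := exists_eq_X_add_C_of_natDegree_le_one hd
  refine ⟨u, v, ?_⟩
  have h := congrArg (aeval β) (modByMonic_add_div p (X ^ 2 - C e))
  rw [map_add, map_mul, huv] at h
  simp only [map_sub, map_add, map_mul, map_pow, aeval_X, aeval_C, hβ, sub_self, zero_mul,
    add_zero] at h
  show aeval β p = _
  rw [← h, add_comm]

open IntermediateField in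
theorem finrank_adjoin_sqrt {L M : Type*} [Field L] [Field M] [Algebra L M] {β : M} {e : L}
    (hβ : β ^ 2 = algebraMap L M e) (he : ¬ IsSquare e) : Module.finrank L L⟮β⟯ = 2 := by
  have hint : IsIntegral L β := by
    refine IsIntegral.of_pow (n := 2) two_pos ?_
    rw [hβ]
    exact isIntegral_algebraMap
  have hirr : Irreducible (X ^ 2 - C e) :=
    X_pow_sub_C_irreducible_of_prime Nat.prime_two fun b hb => he ⟨b, by rw [← hb, sq]⟩
  rw [adjoin.finrank hint, ← minpoly.eq_of_irreducible_of_monic hirr (by simp [hβ])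
    (monic_X_pow_sub_C e two_ne_zero), natDegree_X_pow_sub_C]

open IntermediateField in
theorem finrank_adjoin_sqrts {L M ι : Type*} [Field L] [Field M] [Algebra L M]
    (h2 : (2 : L) ≠ 0) [DecidableEq ι] {e : ι → L} {β : ι → M}
    (hβ : ∀ i, β i ^ 2 = algebraMap L M (e i)) (S : Finset ι)
    (he : ∀ T ⊆ S, T.Nonempty → ¬ IsSquare (∏ i ∈ T, e i)) :
    Module.finrank L (adjoin L (β '' S)) = 2 ^ S.card ∧
      ∀ a : L, (∃ w ∈ adjoin L (β '' S), w ^ 2 = algebraMap L M a) →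
        ∃ T ⊆ S, IsSquare (a * ∏ i ∈ T, e i) := by
  induction S using Finset.induction_on with
  | empty =>
    refine ⟨by simp, ?_⟩
    rintro a ⟨w, hw, hwa⟩
    simp only [Finset.coe_empty, Set.image_empty, adjoin_empty, mem_bot] at hw
    obtain ⟨u, rfl⟩ := hw
    refine ⟨∅, le_rfl, u, ?_⟩
    rw [← map_pow] at hwa
    simpa [sq] using ((algebraMap L M).injective hwa).symm
  | insert j S hj ih =>
    obtain ⟨ih1, ih2⟩ := ih fun T hT => he T (hT.trans (Finset.subset_insert _ _))
    set E := adjoin L (β '' S) with hE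
    have hej (T : Finset ι) (hT : T ⊆ S) : ¬ IsSquare (e j * ∏ i ∈ T, e i) := by
      rw [← Finset.prod_insert fun h => hj (hT h)]
      exact he _ (Finset.insert_subset_insert _ hT) (Finset.insert_nonempty _ _)
    have hnsq : ¬ IsSquare (algebraMap L E (e j)) := by
      rintro ⟨w, hw⟩
      obtain ⟨T, hT, hsq⟩ := ih2 (e j) ⟨w, w.2, by
        rw [sq]; exact (congrArg (algebraMap E M) hw).symm⟩
      exact hej T hT hsq
    have hβj : β j ^ 2 = algebraMap E M (algebraMap L E (e j)) := hβ j
    have hadj : adjoin L (β '' ↑(insert j S)) = (E⟮β j⟯).restrictScalars L := by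
      rw [hE, adjoin_adjoin_left, Finset.coe_insert, Set.image_insert_eq, Set.union_singleton]
    constructor
    · rw [hadj, Finset.card_insert_of_notMem hj, pow_succ, ← ih1, ← finrank_adjoin_sqrt hβj hnsq]
      exact (Module.finrank_mul_finrank L E E⟮β j⟯).symm
    · rintro a ⟨w, hw, hwa⟩
      rw [hadj, mem_restrictScalars] at hw
      obtain ⟨u, v, rfl⟩ := mem_adjoin_sqrt hβj hw
      have key : algebraMap E M (u ^ 2 + v ^ 2 * algebraMap L E (e j) - algebraMap L E a)
          + algebraMap E M (2 * u * v) * β j = 0 := by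
        simp only [map_sub, map_add, map_mul, map_pow, map_ofNat]
        rw [← hβj, ← IsScalarTower.algebraMap_apply L E M, ← hwa]
        ring
      have huv : 2 * u * v = 0 := by
        by_contra h
        refine hnsq ⟨-(u ^ 2 + v ^ 2 * algebraMap L E (e j) - algebraMap L E a) / (2 * u * v), ?_⟩
        apply (algebraMap E M).injective
        rw [← sq, map_pow, ← hβj]
        congr 1
        have h' : algebraMap E M (2 * u * v) ≠ 0 := by simpa using h
        rw [map_div₀, map_neg, eq_div_iff h']
        linear_combination key
      rw [huv, map_zero, zero_mul, add_zero, map_eq_zero] at key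
      have h2E : (2 : E) ≠ 0 := by
        rw [← map_ofNat (algebraMap L E)]
        exact (_root_.map_ne_zero _).mpr h2
      have huv' : u = 0 ∨ v = 0 := by simpa [h2E] using huv
      rcases huv' with rfl | rfl
      · obtain ⟨T, hT, hsq⟩ := ih2 (a * e j) ⟨algebraMap E M (v * algebraMap L E (e j)),
          (v * algebraMap L E (e j)).2, by
            rw [← map_pow, IsScalarTower.algebraMap_apply L E M, map_mul]
            congr 1
            linear_combination algebraMap L E (e j) * key⟩
        refine ⟨insert j T, Finset.insert_subset_insert _ hT, ?_⟩
        rwa [Finset.prod_insert fun h => hj (hT h), ← mul_assoc]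
      · obtain ⟨T, hT, hsq⟩ := ih2 a ⟨algebraMap E M u, u.2, by
            rw [← map_pow, IsScalarTower.algebraMap_apply L E M]
            congr 1
            linear_combination key⟩
        exact ⟨T, hT.trans (Finset.subset_insert _ _), hsq⟩

open scoped Pointwise in
/-- A 2-group acting transitively on the roots propagates a square product over some of the roots
to the product over all roots. -/
theorem isSquare_prod_roots_of_isPGroup {K L : Type*} [Field K] [Field L] [Algebra K L]
    [Normal K L] (hG : IsPGroup 2 (L ≃ₐ[K] L)) {P : K[X]} (hP : Irreducible P) {c : K}
    (hc : P.eval c ≠ 0) (R : Finset L) (hR : ∀ α, α ∈ R ↔ aeval α P = 0)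
    {S₀ : Finset L} (hS₀ : S₀ ⊆ R)
    (hne : S₀.Nonempty) (hsq : IsSquare (∏ α ∈ S₀, (α - algebraMap K L c))) :
    IsSquare (∏ α ∈ R, (α - algebraMap K L c)) := by
  classical
  have hsmul (σ : L ≃ₐ[K] L) (S : Finset L) :
      ∏ α ∈ σ • S, (α - algebraMap K L c) = σ (∏ α ∈ S, (α - algebraMap K L c)) := by
    rw [Finset.smul_finset_def, Finset.prod_image ((MulAction.injective σ).injOn), map_prod]
    exact Finset.prod_congr rfl fun α _ => by simp
  have hsmulR (σ : L ≃ₐ[K] L) {S : Finset L} (hS : S ⊆ R) : σ • S ⊆ R := by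
    intro x hx
    obtain ⟨α, hα, rfl⟩ := Finset.mem_smul_finset.mp hx
    have := (hR α).mp (hS hα)
    rw [hR, AlgEquiv.smul_def, aeval_algHom_apply, this, map_zero]
  let Y : SubMulAction (L ≃ₐ[K] L) (Finset L) :=
    { carrier := {S | S ⊆ R ∧ IsSquare (∏ α ∈ S, (α - algebraMap K L c))}
      smul_mem' := fun σ S hS => ⟨hsmulR σ hS.1, by rw [hsmul]; exact hS.2.map σ⟩ }
  have hYmem (S : Finset L) :
      S ∈ Y ↔ S ⊆ R ∧ IsSquare (∏ α ∈ S, (α - algebraMap K L c)) := Iff.rfl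
  have : Finite Y := Finite.of_injective (β := R.powerset)
    (fun S => ⟨S.1, Finset.mem_powerset.mpr S.2.1⟩) fun S T h => Subtype.ext (by simpa using h)
  let _ := Fintype.ofFinite Y
  have hsymm {S T : Finset L} (hS : S ∈ Y) (hT : T ∈ Y) : symmDiff S T ∈ Y := by
    refine ⟨fun x hx => ?_, ?_⟩
    · rcases Finset.mem_symmDiff.mp hx with h | h
      exacts [hS.1 h.1, hT.1 h.1]
    · have h1 : (∏ α ∈ symmDiff S T, (α - algebraMap K L c))
          * (∏ α ∈ S ∩ T, (α - algebraMap K L c)) ^ 2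
          = (∏ α ∈ S, (α - algebraMap K L c)) * ∏ α ∈ T, (α - algebraMap K L c) := by
        rw [symmDiff_def, Finset.sup_eq_union, Finset.prod_union (disjoint_sdiff_sdiff),
          ← Finset.prod_sdiff (s₁ := S ∩ T) (s₂ := S) Finset.inter_subset_left,
          ← Finset.prod_sdiff (s₁ := S ∩ T) (s₂ := T) Finset.inter_subset_right,
          Finset.sdiff_inter_self_left, Finset.sdiff_inter_self_right]
        ring
      have h2 : ∏ α ∈ S ∩ T, (α - algebraMap K L c) ≠ 0 := by
        refine Finset.prod_ne_zero_iff.mpr fun α hα h => hc ?_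
        have h3 := (hR α).mp (hS.1 (Finset.mem_inter.mp hα).1)
        rwa [sub_eq_zero.mp h, aeval_algebraMap_apply_eq_algebraMap_eval, map_eq_zero] at h3
      rw [eq_div_of_mul_eq (pow_ne_zero 2 h2) h1]
      exact (hS.2.mul hT.2).div (IsSquare.sq _)
  have hdvd : 2 ∣ Nat.card Y := by
    rw [← ZMod.natCast_eq_zero_iff, Nat.card_eq_fintype_card]
    have := Finset.sum_involution (s := (Finset.univ : Finset Y)) (f := fun _ => (1 : ZMod 2))
      (fun S _ => ⟨symmDiff S.1 S₀, hsymm S.2 ⟨hS₀, hsq⟩⟩) (fun _ _ => by decide)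
      (fun S _ _ h => by
        have h' := congrArg Subtype.val h
        simp only [symmDiff_eq_left] at h'
        exact hne.ne_empty h')
      (fun _ _ => Finset.mem_univ _) (fun S _ => Subtype.ext (by simp))
    simpa using this
  have hempty : (⟨∅, by simp [hYmem]⟩ : Y) ∈ MulAction.fixedPoints (L ≃ₐ[K] L) Y := by
    intro σ
    exact Subtype.ext (by simp)
  obtain ⟨S, hS, hSne⟩ := hG.exists_fixed_point_of_prime_dvd_card_of_fixed_point Y hdvd hempty
  have hSfix (σ : L ≃ₐ[K] L) : σ • S.1 = S.1 := congrArg Subtype.val (hS σ)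
  obtain ⟨α, hα⟩ : S.1.Nonempty := by
    rw [Finset.nonempty_iff_ne_empty]
    exact fun h => hSne (Subtype.ext h.symm)
  have hSR : S.1 = R := by
    refine Finset.Subset.antisymm S.2.1 fun β hβ => ?_
    have h1 := minpoly.eq_of_irreducible hP ((hR α).mp (S.2.1 hα))
    have h2 := minpoly.eq_of_irreducible hP ((hR β).mp hβ)
    obtain ⟨σ, hσ⟩ :=
      (isConjRoot_iff_exists_algEquiv (K := K) (x := β) (y := α)).mp (h2.symm.trans h1)
    rw [← hSfix σ, ← hσ]
    exact Finset.smul_mem_smul_finset hα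
  rw [← hSR]
  exact S.2.2

section Galois

variable {K : Type*} [Field K] (g c : K)

theorem pow_two_pow_apply_root {L : Type*} [Field L] [Algebra K L] (σ : L ≃ₐ[K] L) (n : ℕ) (β : L)
    (hβ : aeval β (quadIter g c n) = 0) : (σ ^ 2 ^ n) β = β := by
  induction n generalizing β with
  | zero =>
    obtain rfl : β = 0 := by simpa [quadIter_zero] using hβ
    simp
  | succ n ih =>
    rw [quadIter_succ, aeval_comp] at hβ
    have h := ih _ hβ
    rw [pow_succ, pow_mul, sq, AlgEquiv.mul_apply]
    set τ := σ ^ 2 ^ n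
    have h1 : (τ β - algebraMap K L g) ^ 2 = (β - algebraMap K L g) ^ 2 := by
      simpa using h
    rcases sq_eq_sq_iff_eq_or_eq_neg.mp h1 with h2 | h2
    · have : τ β = β := by linear_combination h2
      rw [this, this]
    · have h3 : τ β = 2 * algebraMap K L g - β := by linear_combination h2
      rw [h3, map_sub, map_mul, map_ofNat, AlgEquiv.commutes, h3]
      ring

theorem isPGroup_gal_quadIter {P : K[X]} (n : ℕ) (hP : P = quadIter g c n) :
    IsPGroup 2 (P.SplittingField ≃ₐ[K] P.SplittingField) := by
  intro σ
  refine ⟨n, ?_⟩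
  have h : ((σ ^ 2 ^ n : P.SplittingField ≃ₐ[K] P.SplittingField) :
      P.SplittingField →ₐ[K] P.SplittingField) = AlgHom.id K _ := by
    refine AlgHom.ext_of_adjoin_eq_top (SplittingField.adjoin_rootSet P) fun β hβ => ?_
    exact pow_two_pow_apply_root g c σ n β (hP ▸ aeval_eq_zero_of_mem_rootSet hβ)
  exact AlgEquiv.ext fun x => DFunLike.congr_fun h x

theorem finrank_splittingField_quadIter [CharZero K] {P Q : K[X]} {n : ℕ} (hn : n ≠ 0)
    (hP : P = quadIter g c n) (hQ : Q = quadIter g c (n + 1)) (hirr : Irreducible P)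
    (hb : (fun a => (a - g) ^ 2 + c)^[n + 1] g ≠ 0)
    (hsq : ¬ IsSquare (algebraMap K P.SplittingField ((fun a => (a - g) ^ 2 + c)^[n + 1] g))) :
    Module.finrank P.SplittingField (Q.map (algebraMap K P.SplittingField)).SplittingField
      = 2 ^ 2 ^ n := by
  classical
  have hPc : P.eval c = (fun a => (a - g) ^ 2 + c)^[n + 1] g := by
    rw [hP, eval_quadIter, Function.iterate_succ_apply]
    simp
  have hPm : P.Monic := hP ▸ quadIter_monic g c n
  have hPd : P.natDegree = 2 ^ n := hP ▸ natDegree_quadIter g c n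
  let L := P.SplittingField
  let M := (Q.map (algebraMap K L)).SplittingField
  let R : Finset L := (P.aroots L).toFinset
  have hR (α : L) : α ∈ R ↔ aeval α P = 0 := by
    simp [R, hirr.ne_zero]
  have hnodup : (P.aroots L).Nodup :=
    (nodup_aroots_iff_of_splits hirr.ne_zero (SplittingField.splits P)).mpr hirr.separable
  have hRval : R.val = P.aroots L := by simp [R, Multiset.dedup_eq_self.mpr hnodup]
  have hPprod : P.map (algebraMap K L) = ∏ α ∈ R, (X - C α) := by
    rw [Finset.prod, hRval]
    exact (SplittingField.splits P).eq_prod_roots_of_monic (hPm.map _)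
  have hRcard : R.card = 2 ^ n := by
    have := congrArg natDegree hPprod
    rw [natDegree_map, natDegree_prod_of_monic _ _ fun α _ => monic_X_sub_C α, hPd] at this
    simpa using this.symm
  have hprodc : ∏ α ∈ R, (α - algebraMap K L c) = algebraMap K L (P.eval c) := by
    rw [← aeval_algebraMap_apply_eq_algebraMap_eval, ← eval_map_algebraMap, hPprod, eval_prod]
    have heven : Even R.card := by
      rw [hRcard]
      exact (even_two).pow_of_ne_zero hn
    rw [← one_mul (∏ α ∈ R, (α - algebraMap K L c)), ← heven.neg_one_pow, ← Finset.prod_const,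
      ← Finset.prod_mul_distrib]
    exact Finset.prod_congr rfl fun α _ => by simp
  have hQprod : Q.map (algebraMap K L)
      = ∏ α ∈ R, ((X - C (algebraMap K L g)) ^ 2 - C (α - algebraMap K L c)) := by
    rw [hQ, quadIter_succ, ← hP, map_comp, hPprod, prod_comp]
    refine Finset.prod_congr rfl fun α _ => ?_
    simp
    ring
  have hβ (α : R) : ∃ β : M, β ^ 2 = algebraMap L M (α.1 - algebraMap K L c) := by
    let f : L[X] := (X - C (algebraMap K L g)) ^ 2 - C (α.1 - algebraMap K L c)
    have hfQ : f ∣ Q.map (algebraMap K L) := hQprod ▸ Finset.dvd_prod_of_mem _ α.2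
    have hQ0 : Q ≠ 0 := hQ ▸ (quadIter_monic g c (n + 1)).ne_zero
    have hf : (f.map (algebraMap L M)).Splits :=
      (SplittingField.splits (Q.map (algebraMap K L))).of_dvd
        (Polynomial.map_ne_zero (Polynomial.map_ne_zero hQ0)) (Polynomial.map_dvd _ hfQ)
    have hfd : f.natDegree = 2 := by
      have := natDegree_sq_add (algebraMap K L g) (-(α.1 - algebraMap K L c))
      rwa [C_neg, ← sub_eq_add_neg] at this
    obtain ⟨ρ, hρ⟩ := hf.exists_eval_eq_zero fun h => by
      have := natDegree_eq_of_degree_eq_some h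
      rw [natDegree_map, hfd] at this
      exact two_ne_zero this
    refine ⟨ρ - algebraMap L M (algebraMap K L g), ?_⟩
    simpa [f, sub_eq_zero] using hρ
  choose β hβ using hβ
  have hadj : IntermediateField.adjoin L (β '' (Finset.univ : Finset R)) = ⊤ := by
    rw [eq_top_iff, ← IntermediateField.toSubalgebra_le_toSubalgebra,
      IntermediateField.top_toSubalgebra, ← SplittingField.adjoin_rootSet, Algebra.adjoin_le_iff]
    intro ρ hρ
    have h0 := (congrArg (aeval (R := L) (A := M) ρ) hQprod).symm.trans
      (aeval_eq_zero_of_mem_rootSet hρ)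
    rw [map_prod, Finset.prod_eq_zero_iff] at h0
    obtain ⟨α, hα, h0⟩ := h0
    have h1 : (ρ - algebraMap L M (algebraMap K L g)) ^ 2 = β ⟨α, hα⟩ ^ 2 := by
      rw [hβ, ← sub_eq_zero]
      simpa using h0
    have hmem : β ⟨α, hα⟩ ∈ IntermediateField.adjoin L (β '' (Finset.univ : Finset R)) :=
      IntermediateField.subset_adjoin _ _ ⟨_, by simp, rfl⟩
    have hg := IntermediateField.algebraMap_mem
      (IntermediateField.adjoin L (β '' (Finset.univ : Finset R))) (algebraMap K L g)
    rcases sq_eq_sq_iff_eq_or_eq_neg.mp h1 with h2 | h2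
    · rw [eq_add_of_sub_eq h2]
      exact add_mem hmem hg
    · rw [eq_add_of_sub_eq h2]
      exact add_mem (neg_mem hmem) hg
  have hmain := (finrank_adjoin_sqrts (two_ne_zero) hβ Finset.univ fun T _ hT hTsq => by
    apply hsq
    rw [← hPc, ← hprodc]
    refine isSquare_prod_roots_of_isPGroup (isPGroup_gal_quadIter g c n hP) hirr (by rwa [hPc]) R
      hR (S₀ := T.map (Function.Embedding.subtype _)) ?_ (by simpa) ?_
    · intro x hx
      obtain ⟨y, -, rfl⟩ := Finset.mem_map.mp hx
      exact y.2
    · simpa using hTsq).1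
  rw [hadj, IntermediateField.finrank_top', Finset.card_univ, Fintype.card_coe, hRcard] at hmain
  exact hmain

end Galois

theorem two_mul_natDegree_eq_of_derivative {F : Type*} [Field F] [CharZero F] {p q : F[X]}
    (hp : p ≠ 0) (hq : q ≠ 0) (h : 2 * derivative p * q = derivative q * p) :
    2 * p.natDegree = q.natDegree := by
  have deriv_ne {r : F[X]} (hr : r.natDegree ≠ 0) : derivative r ≠ 0 :=
    fun h0 => hr (derivative_eq_zero.mp h0)
  rcases Nat.eq_zero_or_pos p.natDegree with ha | ha
  · by_contra hne
    have hq' := deriv_ne (r := q) (by omega)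
    rw [eq_C_of_natDegree_eq_zero ha] at h hp
    simp only [derivative_C, mul_zero, zero_mul] at h
    exact mul_ne_zero hq' hp h.symm
  rcases Nat.eq_zero_or_pos q.natDegree with hb | hb
  · exfalso
    have hp' := deriv_ne ha.ne'
    rw [eq_C_of_natDegree_eq_zero hb] at h hq
    simp only [derivative_C, zero_mul] at h
    exact mul_ne_zero (mul_ne_zero two_ne_zero hp') hq h
  obtain ⟨a, ha'⟩ : ∃ a, p.natDegree = a + 1 := ⟨p.natDegree - 1, by omega⟩
  obtain ⟨b, hb'⟩ : ∃ b, q.natDegree = b + 1 := ⟨q.natDegree - 1, by omega⟩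
  have h1 : (derivative p * q).coeff (a + (b + 1))
      = p.coeff (a + 1) * (a + 1) * q.coeff (b + 1) := by
    rw [coeff_mul_add_eq_of_natDegree_le (by have := natDegree_derivative_le p; omega) hb'.le,
      coeff_derivative]
  have h2 : (derivative q * p).coeff (b + (a + 1))
      = q.coeff (b + 1) * (b + 1) * p.coeff (a + 1) := by
    rw [coeff_mul_add_eq_of_natDegree_le (by have := natDegree_derivative_le q; omega) ha'.le,
      coeff_derivative]
  have h3 := congrArg (fun r => coeff r (a + (b + 1))) h
  rw [mul_assoc, ← C_ofNat, coeff_C_mul, h1, show a + (b + 1) = b + (a + 1) by ring, h2] at h3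
  have hpc : p.coeff (a + 1) ≠ 0 := by rw [← ha']; simpa using hp
  have hqc : q.coeff (b + 1) ≠ 0 := by rw [← hb']; simpa using hq
  have h4 : (2 * (a + 1) : F) = b + 1 := by
    apply mul_left_cancel₀ (mul_ne_zero hpc hqc)
    linear_combination h3
  rw [ha', hb']
  exact_mod_cast h4

theorem not_dvd_mul_derivative_sq_add {F : Type*} [Field F] [CharZero F] {G s δ : F[X]} {H : ℕ}
    (hδ0 : δ ≠ 0) (hG0 : G ≠ 0) (hδ : δ.natDegree ≤ H) (hs : G.natDegree + 2 * H < s.natDegree) :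
    ¬ s ^ 2 + δ ∣ G * derivative (s ^ 2 + δ) := by
  intro hdvd
  have hs0 : s ≠ 0 := by rintro rfl; simp at hs
  have hW0 : 2 * derivative s * δ - derivative δ * s ≠ 0 := by
    intro h
    have := two_mul_natDegree_eq_of_derivative hs0 hδ0 (sub_eq_zero.mp h)
    omega
  have hW : (2 * derivative s * δ - derivative δ * s).natDegree ≤ s.natDegree + H := by
    have h1 := natDegree_derivative_le s
    have h2 := natDegree_derivative_le δ
    refine (natDegree_sub_le _ _).trans (max_le ?_ ?_)
    · rw [mul_assoc, ← C_ofNat]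
      refine (natDegree_C_mul_le _ _).trans (natDegree_mul_le.trans ?_)
      omega
    · refine natDegree_mul_le.trans ?_
      omega
  have hdiv : s ^ 2 + δ ∣ G * δ * (2 * derivative s * δ - derivative δ * s) := by
    obtain ⟨e, he⟩ := hdvd
    refine ⟨(2 * derivative s * δ - derivative δ * s) * G - s * (δ * e - derivative δ * G), ?_⟩
    simp only [derivative_add, derivative_pow, map_natCast] at he
    simp at he
    linear_combination (-s * δ) * he
  have hle := natDegree_le_of_dvd hdiv (mul_ne_zero (mul_ne_zero hG0 hδ0) hW0)
  have hd : (s ^ 2 + δ).natDegree = 2 * s.natDegree := by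
    rw [natDegree_add_eq_left_of_natDegree_lt] <;> rw [natDegree_pow]
    omega
  have h3 : (G * δ * (2 * derivative s * δ - derivative δ * s)).natDegree
      ≤ G.natDegree + H + (s.natDegree + H) :=
    natDegree_mul_le.trans (add_le_add (natDegree_mul_le.trans (by omega)) hW)
  omega

/-- The curve `d Y² = ((S² + δ)² + δ)² + c` has no polynomial point `(S, Y)` with `S` of large
degree. -/
theorem sq_add_ne_mul_sq {F : Type*} [Field F] [CharZero F] {d y s δ c : F[X]} {H B : ℕ}
    (hδ0 : δ ≠ 0) (hc0 : c ≠ 0) (hb0 : δ ^ 2 + c ≠ 0) (hδ : δ.natDegree ≤ H) (hc : c.natDegree ≤ H)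
    (hd : d.natDegree ≤ B) (hs : B + 7 * H < s.natDegree) :
    ((s ^ 2 + δ) ^ 2 + δ) ^ 2 + c ≠ d * y ^ 2 := by
  intro h
  obtain ⟨x, hx⟩ : ∃ x, x = s ^ 2 + δ := ⟨_, rfl⟩
  obtain ⟨z, hz⟩ : ∃ z, z = x ^ 2 + δ := ⟨_, rfl⟩
  rw [← hx, ← hz] at h
  have hxd : x.natDegree = 2 * s.natDegree := by
    rw [hx, natDegree_add_eq_left_of_natDegree_lt] <;> rw [natDegree_pow]
    omega
  have hzd : z.natDegree = 2 * x.natDegree := by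
    rw [hz, natDegree_add_eq_left_of_natDegree_lt] <;> rw [natDegree_pow]
    omega
  have hbd : (z ^ 2 + c).natDegree = 2 * z.natDegree := by
    rw [natDegree_add_eq_left_of_natDegree_lt] <;> rw [natDegree_pow]
    omega
  have hz0 : z ≠ 0 := by rintro rfl; simp at hzd; omega
  have hx0 : x ≠ 0 := by rintro rfl; simp at hxd; omega
  have hd0 : d ≠ 0 := by rintro rfl; rw [h] at hbd; simp at hbd; omega
  have hy0 : y ≠ 0 := by rintro rfl; rw [h] at hbd; simp at hbd; omega
  have hyd : d.natDegree + 2 * y.natDegree = 2 * z.natDegree := by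
    rw [← hbd, h, natDegree_mul hd0 (pow_ne_zero 2 hy0), natDegree_pow]
  have h' := congrArg derivative h
  simp only [derivative_add, derivative_pow, derivative_mul, Nat.cast_ofNat, map_ofNat,
    Nat.add_one_sub_one, pow_one] at h'
  obtain ⟨W, hW⟩ : ∃ W, W = derivative c * z - 2 * c * derivative z := ⟨_, rfl⟩
  obtain ⟨q, hq⟩ : ∃ q, c * W = y * q := by
    refine ⟨d * y * W
      - z * (derivative c * d * y - c * derivative d * y - 2 * c * d * derivative y), ?_⟩
    subst hW
    have e : z * (derivative c * z - 2 * c * derivative z)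
        = y * (derivative c * d * y - c * derivative d * y - 2 * c * d * derivative y) := by
      linear_combination derivative c * h - c * h'
    linear_combination (derivative c * z - 2 * c * derivative z) * h - z * e
  have hW0 : W ≠ 0 := by
    intro hW0
    rw [hW, sub_eq_zero] at hW0
    have := two_mul_natDegree_eq_of_derivative hz0 hc0 (by rw [hW0]; ring)
    omega
  have hq0 : q ≠ 0 := by rintro rfl; exact mul_ne_zero hc0 hW0 (by simpa using hq)
  have hWd : W.natDegree ≤ z.natDegree + H := by
    have h1 := natDegree_derivative_le z
    have h2 := natDegree_derivative_le c
    rw [hW]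
    refine (natDegree_sub_le _ _).trans (max_le ?_ ?_)
    · refine natDegree_mul_le.trans ?_
      omega
    · rw [mul_assoc, ← C_ofNat]
      refine (natDegree_C_mul_le _ _).trans (natDegree_mul_le.trans ?_)
      omega
  have hqd : 2 * q.natDegree ≤ 4 * H + d.natDegree := by
    have h1 := congrArg natDegree hq
    rw [natDegree_mul hc0 hW0, natDegree_mul hy0 hq0] at h1
    omega
  have hode : q ^ 2 * (z ^ 2 + c) = d * c ^ 2 * W ^ 2 := by
    linear_combination q ^ 2 * h - d * (c * W + y * q) * hq
  obtain ⟨f, hf⟩ : ∃ f, f = derivative c * δ - 2 * c * derivative δ := ⟨_, rfl⟩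
  obtain ⟨e, he⟩ : ∃ e, e = derivative c * x - 4 * c * derivative x := ⟨_, rfl⟩
  have hWe : W = x * e + f := by
    subst hW hf he hz
    simp only [derivative_add, derivative_pow, Nat.cast_ofNat, map_ofNat,
      Nat.add_one_sub_one, pow_one]
    ring
  have hfd : f.natDegree ≤ 2 * H := by
    have h1 := natDegree_derivative_le δ
    have h2 := natDegree_derivative_le c
    rw [hf]
    refine (natDegree_sub_le _ _).trans (max_le ?_ ?_)
    · refine natDegree_mul_le.trans ?_
      omega
    · rw [mul_assoc, ← C_ofNat]
      refine (natDegree_C_mul_le _ _).trans (natDegree_mul_le.trans ?_)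
      omega
  have hconst : q ^ 2 * (δ ^ 2 + c) = d * c ^ 2 * f ^ 2 := by
    rw [← sub_eq_zero]
    refine eq_zero_of_dvd_of_natDegree_lt (p := x) ?_ ?_
    · refine ⟨d * c ^ 2 * (x * e ^ 2 + 2 * e * f) - q ^ 2 * (x ^ 3 + 2 * x * δ), ?_⟩
      rw [hWe, hz] at hode
      linear_combination hode
    · have h1 : (q ^ 2 * (δ ^ 2 + c)).natDegree ≤ 2 * q.natDegree + 2 * H := by
        refine natDegree_mul_le.trans (add_le_add natDegree_pow_le ?_)
        refine (natDegree_add_le _ _).trans (max_le (natDegree_pow_le.trans ?_) ?_) <;> omega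
      have h2 : (d * c ^ 2 * f ^ 2).natDegree ≤ d.natDegree + 2 * H + 4 * H := by
        refine natDegree_mul_le.trans (add_le_add (natDegree_mul_le.trans
          (add_le_add le_rfl (natDegree_pow_le.trans ?_))) (natDegree_pow_le.trans ?_)) <;> omega
      have := natDegree_sub_le (q ^ 2 * (δ ^ 2 + c)) (d * c ^ 2 * f ^ 2)
      omega
  have hf0 : f ≠ 0 := by
    rintro rfl
    exact mul_ne_zero (pow_ne_zero 2 hq0) hb0 (by simpa using hconst)
  refine not_dvd_mul_derivative_sq_add (G := C 8 * (d * c ^ 3 * f)) (s := s) (H := H)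
    hδ0 ?_ hδ ?_ ?_
  · have : (C 8 : F[X]) ≠ 0 := by simp
    exact mul_ne_zero this (mul_ne_zero (mul_ne_zero hd0 (pow_ne_zero _ hc0)) hf0)
  · have h1 : (d * c ^ 3 * f).natDegree ≤ d.natDegree + 3 * H + 2 * H :=
      natDegree_mul_le.trans (add_le_add (natDegree_mul_le.trans
          (add_le_add le_rfl (natDegree_pow_le.trans (by omega)))) (by omega))
    have := natDegree_C_mul_le (8 : F) (d * c ^ 3 * f)
    omega
  · rw [← hx]
    refine ⟨d * c ^ 2 * e ^ 2 + 2 * d * c ^ 2 * derivative c * f - q ^ 2 * (x ^ 2 + 2 * δ), ?_⟩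
    apply mul_left_cancel₀ hx0
    rw [hWe, hz] at hode
    rw [show (C 8 : F[X]) = 8 from rfl]
    subst he
    linear_combination hode - hconst

theorem exists_eq_prod_odd_roots_mul_sq {F : Type*} [Field F] [IsAlgClosed F] [DecidableEq F]
    (p : F[X]) :
    ∃ y, p = (∏ θ ∈ p.roots.toFinset with Odd (p.rootMultiplicity θ), (X - C θ)) * y ^ 2 := by
  obtain ⟨r, hr⟩ := IsAlgClosed.exists_pow_nat_eq p.leadingCoeff two_pos
  refine ⟨C r * ∏ θ ∈ p.roots.toFinset, (X - C θ) ^ (p.rootMultiplicity θ / 2), ?_⟩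
  conv_lhs => rw [(IsAlgClosed.splits p).eq_prod_roots, Finset.prod_multiset_map_count]
  rw [mul_pow, ← C_pow, hr, Finset.prod_filter, ← Finset.prod_pow, mul_left_comm,
    ← Finset.prod_mul_distrib]
  congr 1
  refine Finset.prod_congr rfl fun θ _ => ?_
  rw [count_roots]
  split_ifs with h
  · conv_lhs => rw [← Nat.two_mul_div_two_add_one_of_odd h]
    ring
  · conv_lhs => rw [← Nat.two_mul_div_two_of_even (Nat.not_odd_iff_even.mp h)]
    ring

theorem natDegree_iterate_sq_add_le {F : Type*} [Field F] {γ c a : F[X]} {H : ℕ}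
    (hγ : γ.natDegree ≤ H) (hc : c.natDegree ≤ H) (ha : a.natDegree ≤ H) (m : ℕ) :
    ((fun a => (a - γ) ^ 2 + c)^[m] a).natDegree ≤ 2 ^ m * H := by
  induction m with
  | zero => simpa
  | succ m ih =>
    rw [Function.iterate_succ_apply']
    have h1 : H ≤ 2 ^ m * H := Nat.le_mul_of_pos_left _ (by positivity)
    refine (natDegree_add_le _ _).trans (max_le (natDegree_pow_le.trans ?_)
      (by rw [pow_succ]; linarith))
    rw [pow_succ]
    have := natDegree_sub_le ((fun a => (a - γ) ^ 2 + c)^[m] a) γ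
    have : ((fun a => (a - γ) ^ 2 + c)^[m] a - γ).natDegree ≤ 2 ^ m * H := by omega
    linarith

theorem natDegree_iterate_sub {F : Type*} [Field F] {γ c : F[X]}
    (h : (γ - c).natDegree ≠ 0) (m : ℕ) :
    ((fun a => (a - γ) ^ 2 + c)^[m + 1] γ - γ).natDegree = 2 ^ m * (γ - c).natDegree := by
  induction m with
  | zero => simpa using natDegree_sub
  | succ m ih =>
    rw [Function.iterate_succ_apply']
    have : ∀ b : F[X], (b - γ) ^ 2 + c - γ = (b - γ) ^ 2 - (γ - c) := fun b => by ring
    rw [this, natDegree_sub_eq_left_of_natDegree_lt] <;> rw [natDegree_pow, ih]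
    · ring
    · have : 0 < 2 ^ m := by positivity
      nlinarith [Nat.pos_of_ne_zero h]

theorem sq_lt_of_logb_lt {n H D : ℕ} (hD : 0 < D) (hH : 0 < H)
    (hn : (n : ℝ) > 2 * Real.logb 2 (78 * (H : ℝ) / (D : ℝ)) + 9) :
    3115008 * H ^ 2 < 2 ^ n * D ^ 2 := by
  have hD' : (0 : ℝ) < D := by exact_mod_cast hD
  have hH' : (0 : ℝ) < H := by exact_mod_cast hH
  have h1 : Real.logb 2 ((78 * (H : ℝ) / D) ^ 2 * 2 ^ 9) < n := by
    rw [Real.logb_mul (by positivity) (by positivity), Real.logb_pow, Real.logb_pow,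
      Real.logb_self_eq_one (by norm_num)]
    push_cast
    linarith
  rw [Real.logb_lt_iff_lt_rpow (by norm_num) (by positivity), Real.rpow_natCast, div_pow,
    div_mul_eq_mul_div, div_lt_iff₀ (by positivity)] at h1
  have h2 : (3115008 * H ^ 2 : ℝ) < 2 ^ n * D ^ 2 := by linarith
  exact_mod_cast h2

theorem add_lt_two_pow_mul {l H D : ℕ} (h : 3115008 * H ^ 2 < 2 ^ (l + 4) * D ^ 2) :
    4 * 2 ^ ((l + 4) / 2) * H + 7 * H < 2 ^ l * D := by
  by_contra! hcon
  have ht1 : 1 ≤ 2 ^ ((l + 4) / 2) := Nat.one_le_two_pow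
  have htN : (2 ^ ((l + 4) / 2)) ^ 2 ≤ 2 ^ (l + 4) := by
    rw [← pow_mul]
    exact Nat.pow_le_pow_right two_pos (by omega)
  have hN0 : 0 < 2 ^ (l + 4) := by positivity
  have hNl : 2 ^ (l + 4) = 16 * 2 ^ l := by ring
  generalize 2 ^ ((l + 4) / 2) = t at *
  generalize 2 ^ (l + 4) = N at *
  have h1 : N * D ≤ 176 * t * H := by
    rw [hNl]
    nlinarith [Nat.mul_le_mul_right H ht1]
  have h2 : (N * D) ^ 2 ≤ N * (30976 * H ^ 2) := by
    calc (N * D) ^ 2 ≤ (176 * t * H) ^ 2 := Nat.pow_le_pow_left h1 2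
      _ = t ^ 2 * (30976 * H ^ 2) := by ring
      _ ≤ N * (30976 * H ^ 2) := Nat.mul_le_mul_right _ htN
  have h3 : N * (3115008 * H ^ 2) < (N * D) ^ 2 := by
    calc N * (3115008 * H ^ 2) < N * (N * D ^ 2) := Nat.mul_lt_mul_of_pos_left h hN0
      _ = (N * D) ^ 2 := by ring
  nlinarith [Nat.zero_le (N * H ^ 2)]

/-- Bound on the roots of `φ^n(γ)` shared with an earlier point of the critical orbit. -/
theorem card_common_roots_le {F : Type*} [Field F] {γ c : F[X]} {H n : ℕ}
    (hγ : γ.natDegree ≤ H) (hc : c.natDegree ≤ H)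
    (hγ0 : ∀ m, 1 ≤ m → (fun a => (a - γ) ^ 2 + c)^[m] γ ≠ 0)
    (h00 : ∀ m, 1 ≤ m → (fun a => (a - γ) ^ 2 + c)^[m] 0 ≠ 0) (T : Finset F)
    (hT : ∀ θ ∈ T, ((fun a => (a - γ) ^ 2 + c)^[n] γ).eval θ = 0 ∧
      ∃ m, 1 ≤ m ∧ m < n ∧ ((fun a => (a - γ) ^ 2 + c)^[m] γ).eval θ = 0) :
    T.card ≤ 4 * 2 ^ (n / 2) * H := by
  classical
  set f : F[X] → F[X] := fun a => (a - γ) ^ 2 + c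
  have heval (θ : F) (m : ℕ) (a : F[X]) :
      (f^[m] a).eval θ = (fun a => (a - γ.eval θ) ^ 2 + c.eval θ)^[m] (a.eval θ) :=
    map_iterate_sub_sq_add γ c (evalRingHom θ) m a
  have hsub : T ⊆ (Finset.range (n / 2)).biUnion
      fun m => (f^[m + 1] γ).roots.toFinset ∪ (f^[m + 1] 0).roots.toFinset := by
    intro θ hθ
    obtain ⟨hn, m, h1, hmn, hm⟩ := hT θ hθ
    simp only [Finset.mem_biUnion, Finset.mem_range, Finset.mem_union, Multiset.mem_toFinset]
    rcases le_or_gt m (n / 2) with h | h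
    · refine ⟨m - 1, by omega, Or.inl ?_⟩
      rw [Nat.sub_add_cancel h1, mem_roots (hγ0 m h1)]
      exact hm
    · refine ⟨n - m - 1, by omega, Or.inr ?_⟩
      rw [Nat.sub_add_cancel (by omega), mem_roots (h00 _ (by omega)), IsRoot, ← hn,
        heval, eval_zero, ← hm, heval, heval, ← Function.iterate_add_apply, Nat.sub_add_cancel hmn.le]
  have hcard (m : ℕ) (a : F[X]) (ha : a.natDegree ≤ H) :
      (f^[m + 1] a).roots.toFinset.card ≤ 2 ^ (m + 1) * H :=
    (Multiset.toFinset_card_le _).trans ((card_roots' _).trans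
      (natDegree_iterate_sq_add_le hγ hc ha (m + 1)))
  calc T.card ≤ ∑ m ∈ Finset.range (n / 2), 2 ^ m * (4 * H) := by
        refine (Finset.card_le_card hsub).trans (Finset.card_biUnion_le.trans
          (Finset.sum_le_sum fun m _ => (Finset.card_union_le _ _).trans ?_))
        have h1 := hcard m γ hγ
        have h2 := hcard m 0 (by simp)
        rw [pow_succ] at h1 h2
        linarith
    _ = (2 ^ (n / 2) - 1) * (4 * H) := by
        rw [← Finset.sum_mul, Nat.geomSum_eq le_rfl]
        simp
    _ ≤ 4 * 2 ^ (n / 2) * H := by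
        rw [mul_comm 4 (2 ^ _), mul_assoc (2 ^ _)]
        exact Nat.mul_le_mul_right _ (Nat.sub_le _ _)

/-- A point of the critical orbit far enough out is not a square in the splitting field of the
preceding iterate. -/
theorem not_isSquare_critical_orbit {k : Type*} [Field k] [CharZero k] {γ c : k[X]} {l : ℕ}
    (hdeg : γ.natDegree = c.natDegree) (hnc : (γ - c).natDegree ≠ 0)
    (hγ0 : ∀ m, 1 ≤ m → (fun a => (a - γ) ^ 2 + c)^[m] γ ≠ 0)
    (h00 : ∀ m, 1 ≤ m → (fun a => (a - γ) ^ 2 + c)^[m] 0 ≠ 0)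
    (hl : 3115008 * γ.natDegree ^ 2 < 2 ^ (l + 4) * (γ - c).natDegree ^ 2)
    {P : (RatFunc k)[X]} (hP : P = quadIter (algebraMap k[X] (RatFunc k) γ)
      (algebraMap k[X] (RatFunc k) c) (l + 3)) :
    ¬ IsSquare (algebraMap (RatFunc k) P.SplittingField
      (algebraMap k[X] (RatFunc k) ((fun a => (a - γ) ^ 2 + c)^[l + 4] γ))) := by
  classical
  intro hsq
  let F := AlgebraicClosure k
  let i : k →+* F := algebraMap k F
  have hi : Function.Injective i := i.injective
  have hmap (m : ℕ) (a : k[X]) : ((fun a => (a - γ) ^ 2 + c)^[m] a).map i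
      = (fun a => (a - γ.map i) ^ 2 + c.map i)^[m] (a.map i) :=
    map_iterate_sub_sq_add γ c (mapRingHom i) m a
  have hγ0' (m : ℕ) (hm : 1 ≤ m) :
      (fun a => (a - γ.map i) ^ 2 + c.map i)^[m] (γ.map i) ≠ 0 := by
    rw [← hmap, Polynomial.map_ne_zero_iff hi]
    exact hγ0 m hm
  have h00' (m : ℕ) (hm : 1 ≤ m) :
      (fun a => (a - γ.map i) ^ 2 + c.map i)^[m] 0 ≠ 0 := by
    have h := (Polynomial.map_ne_zero_iff hi).mpr (h00 m hm)
    rwa [hmap, Polynomial.map_zero] at h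
  have hδd : (γ.map i - c.map i).natDegree = (γ - c).natDegree := by
    rw [← Polynomial.map_sub, natDegree_map]
  have hγd : (γ.map i).natDegree ≤ γ.natDegree := natDegree_map_le
  have hcd : (c.map i).natDegree ≤ γ.natDegree := by rw [hdeg]; exact natDegree_map_le
  set γ' := γ.map i
  set c' := c.map i
  obtain ⟨y, hy⟩ := exists_eq_prod_odd_roots_mul_sq
    ((fun a => (a - γ') ^ 2 + c')^[l + 4] γ')
  set b := (fun a => (a - γ') ^ 2 + c')^[l + 4] γ'
  set T := b.roots.toFinset.filter fun θ => Odd (b.rootMultiplicity θ)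
  have hTcard : T.card ≤ 4 * 2 ^ ((l + 4) / 2) * γ.natDegree := by
    refine card_common_roots_le hγd hcd hγ0' h00' T fun θ hθ => ?_
    obtain ⟨hroot, hodd⟩ := Finset.mem_filter.mp hθ
    refine ⟨(mem_roots'.mp (Multiset.mem_toFinset.mp hroot)).2, ?_⟩
    by_contra! hcon
    refine Nat.not_even_iff_odd.mpr hodd ?_
    have := even_rootMultiplicity_of_isSquare (F := F) γ c (l + 3) θ
      (fun m h1 h2 => by
        have := hcon m h1 (by omega)
        rwa [← hmap] at this) _ (hγ0 (l + 4) (by omega)) P hP hsq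
    rwa [hmap] at this
  have hstep (m : ℕ) : (fun a => (a - γ') ^ 2 + c')^[m + 1] γ'
      = ((fun a => (a - γ') ^ 2 + c')^[m] γ' - γ') ^ 2 + c' := Function.iterate_succ_apply' _ _ _
  have hs := natDegree_iterate_sub (γ := γ') (c := c') (by rwa [hδd]) l
  rw [hδd] at hs
  have hDH : (γ - c).natDegree ≤ γ.natDegree := by
    have := natDegree_sub_le γ c
    rwa [← hdeg, max_self] at this
  have hδ0 : c' - γ' ≠ 0 := by
    intro h
    rw [← neg_sub, neg_eq_zero] at h
    rw [h] at hδd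
    exact hnc (by simpa using hδd.symm)
  refine sq_add_ne_mul_sq (d := ∏ θ ∈ T, (X - C θ)) (y := y)
    (s := (fun a => (a - γ') ^ 2 + c')^[l + 1] γ' - γ') (δ := c' - γ') (c := c')
    (H := γ.natDegree) (B := 4 * 2 ^ ((l + 4) / 2) * γ.natDegree) hδ0 ?_ ?_ ?_ hcd ?_ ?_ ?_
  · simpa using hγ0' 1 le_rfl
  · simpa using hγ0' 2 (by norm_num)
  · rwa [natDegree_sub, hδd]
  · rw [natDegree_finsetProd_X_sub_C_eq_card]
    exact hTcard
  · rw [hs]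
    exact add_lt_two_pow_mul hl
  · rw [← hy]
    simp only [b, hstep]
    ring

/-- Theorem 1 part 2: if `φ = (x-γ)²+c` over `K = k(t)` is stable, post-critically infinite,
`h(γ) = h(c)` and `h(γ-c) ≠ 0`, then `K_n/K_{n-1}` is maximal for all
`n > 2·log₂(78·h(γ)/h(γ-c)) + 9`. -/
theorem maximal_extensions_of_eq_height (k : Type*) [Field k] [CharZero k] (γ c : Polynomial k)
    (φ : Polynomial (RatFunc k))
    (hφ : φ = (X - C (algebraMap (Polynomial k) (RatFunc k) γ)) ^ 2
            + C (algebraMap (Polynomial k) (RatFunc k) c))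
    (hstable : ∀ n : ℕ, 1 ≤ n →
      Irreducible ((fun p => p.comp φ)^[n] (X : Polynomial (RatFunc k))))
    (hpci : Set.Infinite
      {x : Polynomial k | ∃ n : ℕ, 1 ≤ n ∧ (fun a => (a - γ) ^ 2 + c)^[n] γ = x})
    (hdeg : γ.natDegree = c.natDegree)
    (hnc : (γ - c).natDegree ≠ 0) :
    ∀ n : ℕ,
      (n : ℝ) > 2 * Real.logb 2 (78 * (γ.natDegree : ℝ) / ((γ - c).natDegree : ℝ)) + 9 →
      Module.finrank
        (Polynomial.SplittingField ((fun p => p.comp φ)^[n - 1] (X : Polynomial (RatFunc k))))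
        (Polynomial.SplittingField
          (((fun p => p.comp φ)^[n] (X : Polynomial (RatFunc k))).map
            (algebraMap (RatFunc k)
              (Polynomial.SplittingField
                ((fun p => p.comp φ)^[n - 1] (X : Polynomial (RatFunc k)))))))
      = 2 ^ 2 ^ (n - 1) := by
  subst hφ
  intro n hn
  have hD : 0 < (γ - c).natDegree := Nat.pos_of_ne_zero hnc
  have hDH : (γ - c).natDegree ≤ γ.natDegree := by
    have := natDegree_sub_le γ c
    rwa [← hdeg, max_self] at this
  have hineq := sq_lt_of_logb_lt hD (hD.trans_le hDH) hn
  have hn4 : 4 ≤ n := by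
    by_contra! h
    have h1 : 2 ^ n * (γ - c).natDegree ^ 2 ≤ 2 ^ 4 * γ.natDegree ^ 2 :=
      Nat.mul_le_mul (Nat.pow_le_pow_right two_pos h.le) (Nat.pow_le_pow_left hDH 2)
    omega
  obtain ⟨l, rfl⟩ : ∃ l, n = l + 4 := ⟨n - 4, by omega⟩
  have hne (a : k[X]) (m : ℕ) (hm : 1 ≤ m) : (fun a => (a - γ) ^ 2 + c)^[m] a ≠ 0 := by
    intro h
    have hroot : (quadIter (algebraMap k[X] (RatFunc k) γ) (algebraMap k[X] (RatFunc k) c) m).IsRoot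
        (algebraMap k[X] (RatFunc k) a) := by
      rw [IsRoot, eval_quadIter, ← map_iterate_sub_sq_add, h, map_zero]
    have h1 := natDegree_eq_of_degree_eq_some
      (degree_eq_one_of_irreducible_of_root (hstable m hm) hroot)
    exact (Nat.one_lt_two_pow (by omega : m ≠ 0)).ne' ((natDegree_quadIter _ _ m).symm.trans h1)
  have hmap := map_iterate_sub_sq_add γ c (algebraMap k[X] (RatFunc k)) (l + 4) γ
  refine finrank_splittingField_quadIter (algebraMap k[X] (RatFunc k) γ)
    (algebraMap k[X] (RatFunc k) c) (n := l + 3) (by omega) rfl rfl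
    (hstable (l + 3) (by omega)) ?_ ?_
  · rw [← hmap]
    exact (map_ne_zero_iff _ (IsFractionRing.injective k[X] (RatFunc k))).mpr
      (hne γ (l + 4) (by omega))
  · rw [← hmap]
    exact not_isSquare_critical_orbit hdeg hnc (hne γ) (hne 0) hineq rfl
end

section
/- Let k be a field of characteristic zero, K = k(t), and let γ, c ∈ k[t] with φ(x) = (x−γ)² + c. Assume φ is stable, post-critically infinite, h(γ) > 0, and γ − c is a constant (h(γ−c) = 0, i.e. φ is isotrivial). Then the set of integers n ≥ 1 for which the extension K_n/K_{n−1} is not maximal has cardinality at most h(γ) − 1. -/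
open Polynomial

theorem isSquare_powerSeries_of_constantCoeff_ne_zero {L : Type*} [Field L] [IsAlgClosed L]
    [CharZero L] {f : PowerSeries L} (hf : PowerSeries.constantCoeff f ≠ 0) : IsSquare f := by
  obtain ⟨r, hr⟩ := IsAlgClosed.exists_eq_mul_self (PowerSeries.constantCoeff f)
  have hr0 : r ≠ 0 := by
    rintro rfl
    exact hf (by simpa using hr)
  obtain ⟨w, hw, -⟩ := HenselianRing.is_henselian
    (I := Ideal.span {(PowerSeries.X : PowerSeries L)}) (X ^ 2 - C f) (monic_X_pow_sub_C f two_ne_zero) (PowerSeries.C r)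
    (by
      rw [Ideal.mem_span_singleton, PowerSeries.X_dvd_iff]
      simp [hr, sq])
    (by
      refine IsUnit.map _ ?_
      rw [PowerSeries.isUnit_iff_constantCoeff]
      simp [hr0])
  refine ⟨w, ?_⟩
  have : w ^ 2 - f = 0 := by simpa using hw
  linear_combination -this

/-- Square roots of `δ i` generate an extension of degree `2 ^ card ι` as soon as each `δ j` can be
singled out by a homomorphism to a field in which it is the only non-square among the `δ i`. -/
theorem IntermediateField.finrank_adjoin_range_sqrt {F E Ω ι : Type*} [Field F] [Field E]
    [Field Ω] [Algebra F E] [Fintype ι] [DecidableEq ι] (δ : ι → F) (s : ι → E)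
    (hs : ∀ i, s i ^ 2 = algebraMap F E (δ i)) (σ : ι → F →+* Ω)
    (hσ : ∀ i j, IsSquare (σ j (δ i)) ↔ i ≠ j) :
    Module.finrank F (IntermediateField.adjoin F (Set.range s)) = 2 ^ Fintype.card ι := by
  have hint : ∀ i, IsIntegral F (s i) := fun i =>
    ⟨X ^ 2 - C (δ i), monic_X_pow_sub_C _ two_ne_zero, by simp [hs]⟩
  have hnot : ∀ (S : Finset ι) (j : ι), j ∉ S → s j ∉ IntermediateField.adjoin F (s '' S) := by
    intro S j hj hmem
    let := (σ j).toAlgebra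
    obtain ⟨τ⟩ := IntermediateField.nonempty_algHom_adjoin_of_splits (F := F) (K := Ω)
      (S := s '' S) (by
        rintro _ ⟨i, hi, rfl⟩
        refine ⟨hint i, ?_⟩
        obtain ⟨w, hw⟩ := (hσ i j).2 (by rintro rfl; exact hj hi)
        have hd : minpoly F (s i) ∣ X ^ 2 - C (δ i) := minpoly.dvd _ _ (by simp [hs])
        have hsp : ((X ^ 2 - C (δ i) : F[X]).map (algebraMap F Ω)).Splits := by
          have : (X ^ 2 - C (δ i) : F[X]).map (algebraMap F Ω) = (X - C w) * (X + C w) := by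
            simp only [Polynomial.map_sub, Polynomial.map_pow, map_X, map_C,
              RingHom.algebraMap_toAlgebra, hw, C_mul]
            ring
          rw [this]
          exact (Splits.X_sub_C w).mul (Splits.X_add_C w)
        exact hsp.of_dvd ((monic_X_pow_sub_C _ two_ne_zero).map _).ne_zero
          (Polynomial.map_dvd _ hd))
    refine (hσ j j).not.2 (by simp) ⟨τ ⟨s j, hmem⟩, ?_⟩
    rw [← map_mul]
    have : (⟨s j, hmem⟩ * ⟨s j, hmem⟩ : IntermediateField.adjoin F (s '' S)) =
        algebraMap F _ (δ j) := by
      apply Subtype.ext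
      simpa [sq] using hs j
    rw [this, τ.commutes]
    rfl
  have key : ∀ S : Finset ι,
      Module.finrank F (IntermediateField.adjoin F (s '' S)) = 2 ^ S.card := by
    intro S
    induction S using Finset.induction_on with
    | empty => simp
    | insert j S hj ih =>
      set A := IntermediateField.adjoin F (s '' S) with hA
      have h1 : IntermediateField.adjoin F (s '' (insert j S : Finset ι)) =
          (IntermediateField.adjoin A {s j}).restrictScalars F := by
        rw [hA, IntermediateField.adjoin_adjoin_left]
        congr 1
        rw [Finset.coe_insert, Set.image_insert_eq, Set.union_singleton]
      have h2 : Module.finrank A (IntermediateField.adjoin A {s j}) = 2 := by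
        rw [IntermediateField.adjoin.finrank (hint j).tower_top]
        have hroot : aeval (s j) (X ^ 2 - C (algebraMap F A (δ j)) : A[X]) = 0 := by
          simp only [map_sub, map_pow, aeval_X, aeval_C, hs, sub_eq_zero]
          rfl
        have hirr : Irreducible (X ^ 2 - C (algebraMap F A (δ j)) : A[X]) := by
          apply X_pow_sub_C_irreducible_of_prime Nat.prime_two
          intro b hb
          have : s j ^ 2 = (b : E) ^ 2 := by
            rw [hs]
            exact (congrArg (algebraMap A E) hb).symm
          rcases sq_eq_sq_iff_eq_or_eq_neg.1 this with h | h
          · exact hnot S j hj (h ▸ b.2)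
          · exact hnot S j hj (h ▸ (-b).2)
        rw [← minpoly.eq_of_irreducible_of_monic hirr hroot (monic_X_pow_sub_C _ two_ne_zero)]
        exact natDegree_X_pow_sub_C
      rw [h1, Finset.card_insert_of_notMem hj, pow_succ, ← ih, ← h2]
      exact (Module.finrank_mul_finrank F A (IntermediateField.adjoin A {s j})).symm
  have h := key Finset.univ
  rwa [Finset.coe_univ, Set.image_univ, Finset.card_univ] at h

/-- If `p` splits in `Ω` and exactly one of its roots there differs from `c` by a non-square, then
the splitting field of `p ∘ ((X - γ) ^ 2 + c)` has the largest possible degree over that of `p`. -/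
theorem finrank_splittingField_comp {K Ω : Type*} [Field K] [CharZero K] [Field Ω] {p : K[X]}
    (hp : Irreducible p) (γ c : K) (ι : K →+* Ω) (hsplit : (p.map ι).Splits) {b₀ : Ω}
    (hb₀ : (p.map ι).IsRoot b₀) (hns : ¬ IsSquare (b₀ - ι c))
    (hsq : ∀ b, (p.map ι).IsRoot b → b ≠ b₀ → IsSquare (b - ι c)) :
    Module.finrank p.SplittingField
      ((p.comp ((X - C γ) ^ 2 + C c)).map (algebraMap K p.SplittingField)).SplittingField =
      2 ^ p.natDegree := by
  classical
  set F := p.SplittingField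
  set q : F[X] := (p.comp ((X - C γ) ^ 2 + C c)).map (algebraMap K F) with hq
  set E := q.SplittingField
  set γ' := algebraMap K F γ
  set c' := algebraMap K F c
  have hp0 : p ≠ 0 := hp.ne_zero
  have hqcomp : q = (p.map (algebraMap K F)).comp ((X - C γ') ^ 2 + C c') := by
    rw [hq, Polynomial.map_comp]
    simp [γ', c']
  have hdeg : ∀ (M : Type _) [Field M] (x y : M), ((X - C x) ^ 2 + C y : M[X]).natDegree = 2 := by
    intro M _ x y
    rw [natDegree_add_C, natDegree_pow, natDegree_X_sub_C]
  have hpF : p.map (algebraMap K F) ≠ 0 := by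
    simpa [Polynomial.map_eq_zero] using hp0
  have hq0 : q ≠ 0 := by
    rw [hqcomp]
    intro h
    rcases comp_eq_zero_iff.1 h with h | ⟨-, h⟩
    · exact hpF h
    · have h2 := hdeg F γ' c'
      rw [h, natDegree_C] at h2
      omega
  have hroot : ∀ β : p.rootSet F, ∃ x : E,
      (x - algebraMap F E γ') ^ 2 = algebraMap F E (β - c') := by
    intro β
    have hd : ((X - C γ') ^ 2 + C c' - C (β : F)) ∣ q := by
      rw [hqcomp]
      have h1 : (X - C (β : F)) ∣ p.map (algebraMap K F) := by
        rw [dvd_iff_isRoot, IsRoot.def, eval_map_algebraMap]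
        exact aeval_eq_zero_of_mem_rootSet β.2
      obtain ⟨r, hr⟩ := h1
      rw [hr, mul_comp]
      exact Dvd.intro (r.comp ((X - C γ') ^ 2 + C c')) (by simp)
    have hd' := Polynomial.map_dvd (algebraMap F E) hd
    have hs := (SplittingField.splits q).of_dvd
      (by simpa [Polynomial.map_eq_zero] using hq0) hd'
    obtain ⟨x, hx⟩ := hs.exists_eval_eq_zero (by
      rw [degree_map]
      intro h
      have h2 := hdeg F γ' (c' - β)
      rw [C_sub, ← add_sub_assoc, natDegree, h] at h2
      simp at h2)
    refine ⟨x, ?_⟩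
    simp only [Polynomial.map_sub, Polynomial.map_add, Polynomial.map_pow, map_X, map_C, eval_sub,
      eval_add, eval_pow, eval_X, eval_C] at hx
    rw [map_sub]
    linear_combination hx
  choose x hx using hroot
  have hσ : ∀ β : p.rootSet F, ∃ σ : F →+* Ω, σ β = b₀ ∧ σ.comp (algebraMap K F) = ι := by
    intro β
    let := ι.toAlgebra
    let σ₀ : F →ₐ[K] Ω := SplittingField.lift p hsplit
    have hmin : aeval b₀ (minpoly K (β : F)) = 0 := by
      have h1 : aeval (β : F) p = 0 := aeval_eq_zero_of_mem_rootSet β.2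
      obtain ⟨u, hu⟩ := (minpoly.dvd K (β : F) h1)
      have hunit := (hp.isUnit_or_isUnit hu).resolve_left (minpoly.not_isUnit K _)
      have h2 : aeval b₀ p = 0 := by
        rw [← eval_map_algebraMap]
        exact hb₀
      rw [hu, map_mul] at h2
      exact (mul_eq_zero.1 h2).resolve_right (hunit.map (aeval b₀)).ne_zero
    obtain ⟨τ, hτ⟩ := IntermediateField.exists_algHom_of_splits_of_aeval (F := K) (E := F) (K := Ω)
      (x := (β : F)) (y := b₀) (fun s => ⟨Algebra.IsIntegral.isIntegral s, by
        have h := ((Normal.splits (inferInstance : Normal K F) s).map σ₀.toRingHom)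
        rwa [Polynomial.map_map, AlgHom.toRingHom_eq_coe, AlgHom.comp_algebraMap] at h⟩) hmin
    exact ⟨τ, hτ, τ.comp_algebraMap⟩
  choose σ hσb hσK using hσ
  have key := IntermediateField.finrank_adjoin_range_sqrt (F := F) (E := E)
    (fun β : p.rootSet F => (β : F) - c') (fun β => x β - algebraMap F E γ') hx σ (by
      intro i j
      have hc : σ j c' = ι c := by rw [← hσK j]; rfl
      rw [map_sub, hc]
      constructor
      · rintro h rfl
        rw [hσb] at h
        exact hns h
      · intro hij
        apply hsq
        · rw [← hσK j, ← Polynomial.map_map]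
          apply IsRoot.map
          rw [IsRoot.def, eval_map_algebraMap]
          exact aeval_eq_zero_of_mem_rootSet i.2
        · rw [← hσb j]
          exact fun h => hij (Subtype.ext ((σ j).injective h)))
  rw [card_rootSet_eq_natDegree hp.separable (SplittingField.splits p)] at key
  rw [← key]
  suffices h : IntermediateField.adjoin F (Set.range fun β => x β - algebraMap F E γ') = ⊤ by
    rw [h, IntermediateField.finrank_top']
  rw [eq_top_iff, ← IntermediateField.adjoin_eq_top_of_algebra F (q.rootSet E)
    (SplittingField.adjoin_rootSet q), IntermediateField.adjoin_le_iff]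
  intro y hy
  have hy0 : aeval y q = 0 := aeval_eq_zero_of_mem_rootSet hy
  have hy1 : ((p.map (algebraMap K F)).map (algebraMap F E)).IsRoot
      ((y - algebraMap F E γ') ^ 2 + algebraMap F E c') := by
    have h := congrArg (aeval y) hqcomp
    rw [hy0, aeval_comp] at h
    rw [IsRoot.def, eval_map_algebraMap]
    simpa using h.symm
  obtain ⟨β, hβ⟩ := (SplittingField.splits p).mem_range_of_isRoot hpF hy1
  have hβroot : β ∈ p.rootSet F := by
    rw [mem_rootSet]
    refine ⟨hp0, ?_⟩
    rw [← eval_map_algebraMap]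
    rw [← hβ, IsRoot.def, eval_map_apply] at hy1
    exact (map_eq_zero (algebraMap F E)).1 hy1
  have hsq' : (y - algebraMap F E γ') ^ 2 = (x ⟨β, hβroot⟩ - algebraMap F E γ') ^ 2 := by
    rw [hx, map_sub]
    linear_combination -hβ
  have hmem : x ⟨β, hβroot⟩ - algebraMap F E γ' ∈
      IntermediateField.adjoin F (Set.range fun β => x β - algebraMap F E γ') :=
    IntermediateField.subset_adjoin _ _ ⟨_, rfl⟩
  have hγmem : algebraMap F E γ' ∈
      IntermediateField.adjoin F (Set.range fun β => x β - algebraMap F E γ') :=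
    IntermediateField.algebraMap_mem _ _
  rcases sq_eq_sq_iff_eq_or_eq_neg.1 hsq' with h | h
  · rw [sub_eq_iff_eq_add.1 h]
    exact add_mem hmem hγmem
  · rw [sub_eq_iff_eq_add.1 h]
    exact add_mem (neg_mem hmem) hγmem

theorem iterate_comp_right_X {R : Type*} [CommSemiring R] (φ : R[X]) (n : ℕ) :
    (fun p => p.comp φ)^[n] X = φ.comp^[n] X := by
  have h : ∀ (n : ℕ) (q : R[X]), (fun p => p.comp φ)^[n] q = q.comp (φ.comp^[n] X) := by
    intro n
    induction n with
    | zero => simp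
    | succ n ih =>
      intro q
      rw [Function.iterate_succ_apply, ih, comp_assoc, Function.iterate_succ_apply']
  rw [h, X_comp]

theorem not_isSquare_taylor_of_odd_rootMultiplicity {L : Type*} [Field L] {q : L[X]} {t : L}
    (hq : q ≠ 0) (hodd : Odd (q.rootMultiplicity t)) :
    ¬ IsSquare (algebraMap (PowerSeries L) (LaurentSeries L) (taylor t q : L[X])) := by
  rintro ⟨x, hx⟩
  obtain ⟨p, rfl⟩ := IsIntegrallyClosed.exists_algebraMap_eq_of_isIntegral_pow
    (R := PowerSeries L) (x := x) two_pos (by rw [sq, ← hx]; exact isIntegral_algebraMap)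
  rw [← map_mul] at hx
  have hx' := IsFractionRing.injective (PowerSeries L) (LaurentSeries L) hx
  obtain ⟨h, hqh, hnd⟩ := exists_eq_pow_rootMultiplicity_mul_and_not_dvd q hq t
  have hh : PowerSeries.constantCoeff ((taylor t h : L[X]) : PowerSeries L) ≠ 0 := by
    rw [← PowerSeries.coeff_zero_eq_constantCoeff_apply, Polynomial.coeff_coe, taylor_coeff_zero]
    rwa [dvd_iff_isRoot] at hnd
  have ho := congrArg PowerSeries.order hx'
  rw [hqh, taylor_mul, taylor_pow, map_sub, taylor_X, taylor_C, add_sub_cancel_right,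
    Polynomial.coe_mul, Polynomial.coe_pow, Polynomial.coe_X, PowerSeries.order_mul,
    PowerSeries.order_mul, PowerSeries.order_X_pow,
    PowerSeries.order_zero_of_unit (by
      rw [PowerSeries.isUnit_iff_constantCoeff]; exact isUnit_iff_ne_zero.2 hh), add_zero] at ho
  cases hp : p.order with
  | top => rw [hp] at ho; simp at ho
  | coe n =>
    rw [hp] at ho
    have ho' : q.rootMultiplicity t = n + n := by exact_mod_cast ho
    exact Nat.not_even_iff_odd.2 hodd ⟨n, ho'⟩

section PowerSeriesRoots

variable {L : Type*} [Field L] [CharZero L]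

theorem eq_of_iterate_sq_add_C_eq {e u : L} {m : ℕ} (hu : ∀ i < m, (fun x => x ^ 2 + e)^[i] u ≠ 0)
    {y z : PowerSeries L} (hy : PowerSeries.constantCoeff y = u)
    (hz : PowerSeries.constantCoeff z = u)
    (h : (fun x => x ^ 2 + PowerSeries.C e)^[m] y = (fun x => x ^ 2 + PowerSeries.C e)^[m] z) :
    y = z := by
  induction m generalizing y z u with
  | zero => exact h
  | succ m ih =>
    have h1 : y ^ 2 + PowerSeries.C e = z ^ 2 + PowerSeries.C e :=
      ih (u := u ^ 2 + e) (fun i hi => hu (i + 1) (by omega)) (by simp [hy]) (by simp [hz]) h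
    rcases sq_eq_sq_iff_eq_or_eq_neg.1 (add_right_cancel h1) with h2 | h2
    · exact h2
    · have h3 := congrArg PowerSeries.constantCoeff h2
      rw [map_neg, hy, hz] at h3
      exact absurd (self_eq_neg.1 h3) (hu 0 (by omega))

theorem eval_iterate_comp_algebraMap {P Ω : Type*} [CommRing P] [CommRing Ω] [Algebra P Ω]
    (G e y : P) (m : ℕ) :
    (((X - C (algebraMap P Ω G)) ^ 2 + C (algebraMap P Ω (G + e))).comp^[m] X).eval
      (algebraMap P Ω (y + G)) = algebraMap P Ω ((fun x => x ^ 2 + e)^[m] y + G) := by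
  induction m with
  | zero => simp
  | succ m ih =>
    rw [Function.iterate_succ_apply', Function.iterate_succ_apply', eval_comp, ih]
    simp
    ring

variable [IsAlgClosed L]

theorem splits_iterate_comp_sub_C (e : L) (G : PowerSeries L) {Φ : (LaurentSeries L)[X]}
    (hΦ : Φ = (X - C (algebraMap _ _ G)) ^ 2 + C (algebraMap _ _ (G + PowerSeries.C e)))
    (m : ℕ) (z : PowerSeries L)
    (hz : ∀ i < m, PowerSeries.constantCoeff z ≠ (fun x => x ^ 2 + e)^[i + 1] 0) :
    (Φ.comp^[m] X - C (algebraMap _ _ (G + z))).Splits ∧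
      ∀ b, (Φ.comp^[m] X - C (algebraMap _ _ (G + z))).eval b = 0 →
        ∃ y : PowerSeries L, algebraMap _ _ y = b := by
  induction m generalizing z with
  | zero =>
    refine ⟨Splits.X_sub_C _, fun b hb => ⟨G + z, ?_⟩⟩
    simp only [Function.iterate_zero, id_eq, eval_sub, eval_X, eval_C] at hb
    exact (sub_eq_zero.1 hb).symm
  | succ m ih =>
    obtain ⟨w, hw⟩ := isSquare_powerSeries_of_constantCoeff_ne_zero (f := z - PowerSeries.C e) (by
      have := hz 0 (by omega)
      simpa [sub_eq_zero] using this)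
    have hw0 : PowerSeries.constantCoeff z = PowerSeries.constantCoeff w ^ 2 + e := by
      have := congrArg PowerSeries.constantCoeff hw
      simp only [map_sub, map_mul, PowerSeries.constantCoeff_C] at this
      linear_combination this
    have ih₁ := ih w (by
      intro i hi h
      apply hz (i + 1) (by omega)
      rw [Function.iterate_succ_apply', hw0, h])
    have ih₂ := ih (-w) (by
      intro i hi h
      apply hz (i + 1) (by omega)
      rw [Function.iterate_succ_apply', hw0, ← neg_sq, ← map_neg, h])
    have hfac : Φ.comp^[m + 1] X - C (algebraMap _ _ (G + z)) =
        (Φ.comp^[m] X - C (algebraMap _ _ (G + w))) *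
          (Φ.comp^[m] X - C (algebraMap _ _ (G + -w))) := by
      have hz' : z = w * w + PowerSeries.C e := by linear_combination hw
      rw [Function.iterate_succ_apply', hz']
      nth_rewrite 1 [hΦ]
      simp only [add_comp, pow_comp, sub_comp, X_comp, C_comp, map_add, map_mul, map_neg]
      ring
    rw [hfac]
    refine ⟨ih₁.1.mul ih₂.1, fun b hb => ?_⟩
    rw [eval_mul, mul_eq_zero] at hb
    exact hb.elim (ih₁.2 b) (ih₂.2 b)

theorem splits_and_exists_unique_nonsquare_root (e : L) (G : PowerSeries L)
    {Φ : (LaurentSeries L)[X]}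
    (hΦ : Φ = (X - C (algebraMap _ _ G)) ^ 2 + C (algebraMap _ _ (G + PowerSeries.C e)))
    (m : ℕ) (horb : Function.Injective fun i => (fun x => x ^ 2 + e)^[i] 0)
    (hG : PowerSeries.constantCoeff G = -(fun x => x ^ 2 + e)^[m + 1] 0)
    (hns : ¬ IsSquare (algebraMap _ (LaurentSeries L)
      (G + PowerSeries.C ((fun x => x ^ 2 + e)^[m + 1] 0)))) :
    (Φ.comp^[m] X).Splits ∧ ∃ b₀, (Φ.comp^[m] X).IsRoot b₀ ∧
      ¬ IsSquare (b₀ - algebraMap _ _ (G + PowerSeries.C e)) ∧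
      ∀ b, (Φ.comp^[m] X).IsRoot b → b ≠ b₀ →
        IsSquare (b - algebraMap _ _ (G + PowerSeries.C e)) := by
  obtain ⟨hsplit, hroots⟩ := splits_iterate_comp_sub_C e G hΦ m (-G) (by
    intro i hi h
    rw [map_neg, hG, neg_neg] at h
    have := horb h
    omega)
  simp only [add_neg_cancel, map_zero, sub_zero] at hsplit hroots
  have hroots' : ∀ b, (Φ.comp^[m] X).IsRoot b → ∃ y : PowerSeries L,
      b = algebraMap _ _ (y + G) ∧ (fun x => x ^ 2 + PowerSeries.C e)^[m] y = -G := by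
    intro b hb
    obtain ⟨y, rfl⟩ := hroots b hb
    refine ⟨y - G, by rw [sub_add_cancel], ?_⟩
    have h := eval_iterate_comp_algebraMap (Ω := LaurentSeries L) G (PowerSeries.C e) (y - G) m
    rw [← hΦ, sub_add_cancel, hb.eq_zero, eq_comm,
      map_eq_zero_iff _ (IsFractionRing.injective (PowerSeries L) (LaurentSeries L))] at h
    exact eq_neg_of_add_eq_zero_left h
  have hcoeff : ∀ y : PowerSeries L, ¬ IsSquare (algebraMap _ (LaurentSeries L) (y + G) -
      algebraMap _ _ (G + PowerSeries.C e)) → PowerSeries.constantCoeff y = e := by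
    intro y hy
    by_contra hne
    apply hy
    rw [← map_sub]
    refine IsSquare.map _ (isSquare_powerSeries_of_constantCoeff_ne_zero ?_)
    rw [add_comm y G, add_sub_add_left_eq_sub, map_sub, PowerSeries.constantCoeff_C]
    exact sub_ne_zero.2 hne
  have hmonic : (Φ.comp^[m] X).Monic := by
    have hΦm : Φ.Monic ∧ Φ.natDegree ≠ 0 := by
      have h1 : ((X - C (algebraMap _ _ G)) ^ 2 : (LaurentSeries L)[X]).natDegree = 2 := by
        rw [natDegree_pow, natDegree_X_sub_C]
      constructor
      · rw [hΦ]
        refine ((monic_X_sub_C _).pow 2).add_of_left ?_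
        exact degree_C_le.trans_lt (natDegree_pos_iff_degree_pos.1 (by omega))
      · rw [hΦ, natDegree_add_C, h1]
        exact two_ne_zero
    have h : (Φ.comp^[m] X).Monic ∧ (Φ.comp^[m] X).natDegree ≠ 0 := by
      clear hsplit hroots hroots' hG hns
      induction m with
      | zero => exact ⟨monic_X, by simp⟩
      | succ m ih =>
        rw [Function.iterate_succ_apply']
        exact ⟨hΦm.1.comp ih.1 ih.2, by rw [natDegree_comp]; exact mul_ne_zero hΦm.2 ih.2⟩
    exact h.1
  refine ⟨hsplit, ?_⟩
  have hex : ∃ b₀, (Φ.comp^[m] X).IsRoot b₀ ∧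
      ¬ IsSquare (b₀ - algebraMap _ _ (G + PowerSeries.C e)) := by
    by_contra! hall
    apply hns
    have h := eval_iterate_comp_algebraMap (Ω := LaurentSeries L) G (PowerSeries.C e)
      (PowerSeries.C e) m
    have hsemi : (fun x => x ^ 2 + PowerSeries.C e)^[m] (PowerSeries.C e) =
        PowerSeries.C ((fun x => x ^ 2 + e)^[m + 1] 0) := by
      have hs : Function.Semiconj (PowerSeries.C (R := L)) (fun x => x ^ 2 + e)
        (fun x => x ^ 2 + PowerSeries.C e) := fun x => by simp
      rw [Function.iterate_succ_apply, (hs.iterate_right m).eq]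
      simp
    rw [← hΦ, hsplit.eval_eq_prod_roots_of_monic hmonic, hsemi] at h
    rw [add_comm G, ← h, add_comm _ G]
    refine Multiset.prod_induction IsSquare _ (fun _ _ => IsSquare.mul) (IsSquare.one) ?_
    intro a ha
    obtain ⟨b, hb, rfl⟩ := Multiset.mem_map.1 ha
    rw [← neg_sub, ← neg_one_mul]
    refine IsSquare.mul ?_ (hall b (isRoot_of_mem_roots hb))
    have : IsSquare (-1 : PowerSeries L) :=
      isSquare_powerSeries_of_constantCoeff_ne_zero (by simp)
    simpa using this.map (algebraMap _ (LaurentSeries L))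
  obtain ⟨b₀, hb₀, hb₀ns⟩ := hex
  refine ⟨b₀, hb₀, hb₀ns, fun b hb hne => ?_⟩
  by_contra hbns
  apply hne
  obtain ⟨y, rfl, hy⟩ := hroots' b hb
  obtain ⟨y₀, rfl, hy₀⟩ := hroots' b₀ hb₀
  rw [eq_of_iterate_sq_add_C_eq (m := m) (u := e) ?_ (hcoeff y hbns) (hcoeff y₀ hb₀ns)
    (hy.trans hy₀.symm)]
  intro i _ h
  have h0 : (fun x => x ^ 2 + e)^[i + 1] 0 = (fun x => x ^ 2 + e)^[0] 0 := by
    rw [Function.iterate_succ_apply]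
    simpa using h
  have := horb h0
  omega

end PowerSeriesRoots

theorem map_iterate_comp_X {R S : Type*} [CommSemiring R] [CommSemiring S] (f : R →+* S)
    (φ : R[X]) (n : ℕ) : (φ.comp^[n] X).map f = (φ.map f).comp^[n] X := by
  induction n with
  | zero => simp
  | succ n ih => rw [Function.iterate_succ_apply', Function.iterate_succ_apply', map_comp, ih]

theorem finrank_eq_of_odd_rootMultiplicity {k : Type*} [Field k] [CharZero k] {γ c : k[X]} {e : k}
    {L : Type*} [Field L] [IsAlgClosed L] [Algebra k L]
    (hc : c = γ + C e) (horb : Function.Injective fun i => (fun x => x ^ 2 + e)^[i] 0)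
    {φ : (RatFunc k)[X]}
    (hφ : φ = (X - C (algebraMap k[X] (RatFunc k) γ)) ^ 2 + C (algebraMap k[X] (RatFunc k) c))
    (m : ℕ) (hirr : Irreducible ((fun p => p.comp φ)^[m] X)) (hγ : 0 < γ.natDegree)
    {t : L} (hodd : Odd (((γ + C ((fun x => x ^ 2 + e)^[m + 1] 0)).map
      (algebraMap k L)).rootMultiplicity t)) :
    Module.finrank ((fun p => p.comp φ)^[m] X).SplittingField
      (((fun p => p.comp φ)^[m + 1] X).map
        (algebraMap (RatFunc k) ((fun p => p.comp φ)^[m] X).SplittingField)).SplittingField =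
      2 ^ 2 ^ m := by
  have : CharZero L := charZero_of_injective_algebraMap (algebraMap k L).injective
  set a : k := (fun x => x ^ 2 + e)^[m + 1] 0 with ha
  have hsemi : Function.Semiconj (algebraMap k L) (fun x => x ^ 2 + e)
    (fun x => x ^ 2 + algebraMap k L e) := fun x => by simp
  have hiter : ∀ i, (fun x => x ^ 2 + algebraMap k L e)^[i] 0 =
      algebraMap k L ((fun x => x ^ 2 + e)^[i] 0) := by
    intro i
    rw [(hsemi.iterate_right i).eq, map_zero]
  have horbL : Function.Injective fun i => (fun x => x ^ 2 + algebraMap k L e)^[i] 0 := by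
    intro i j hij
    simp only [hiter] at hij
    exact horb ((algebraMap k L).injective hij)
  let ψ : k[X] →+* PowerSeries L := (coeToPowerSeries.ringHom (R := L)).comp
    ((taylorAlgHom t : L[X] →ₐ[L] L[X]).toRingHom.comp (mapRingHom (algebraMap k L)))
  have hψ : ∀ q : k[X], ψ q = (taylor t (q.map (algebraMap k L)) : L[X]) := fun q => rfl
  have hψC : ∀ x : k, ψ (C x) = PowerSeries.C (algebraMap k L x) := by
    intro x
    rw [hψ, map_C, taylor_C, Polynomial.coe_C]
  have hψinj : Function.Injective ψ :=
    (coe_injective L).comp ((taylor_injective t).comp (map_injective _ (algebraMap k L).injective))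
  have hinj : Function.Injective ((algebraMap (PowerSeries L) (LaurentSeries L)).comp ψ) :=
    (IsFractionRing.injective (PowerSeries L) (LaurentSeries L)).comp hψinj
  let ι : RatFunc k →+* LaurentSeries L := IsFractionRing.lift hinj
  have hι : ∀ q : k[X], ι (algebraMap k[X] (RatFunc k) q) = algebraMap _ _ (ψ q) :=
    fun q => IsFractionRing.lift_algebraMap hinj q
  have hιc : ι (algebraMap k[X] (RatFunc k) c) =
      algebraMap _ _ (ψ γ + PowerSeries.C (algebraMap k L e)) := by
    rw [hι, hc, map_add, hψC]
  have hq0 : (γ + C a).map (algebraMap k L) ≠ 0 := by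
    rw [Polynomial.map_ne_zero_iff (algebraMap k L).injective]
    intro h
    have := congrArg natDegree h
    rw [natDegree_add_C, natDegree_zero] at this
    omega
  have hev : ((γ + C a).map (algebraMap k L)).eval t = 0 := by
    have : 0 < ((γ + C a).map (algebraMap k L)).rootMultiplicity t := hodd.pos
    exact (rootMultiplicity_pos hq0).1 this
  obtain ⟨hsplit, b₀, hb₀, hns, hsq⟩ := splits_and_exists_unique_nonsquare_root (algebraMap k L e)
    (ψ γ) (Φ := φ.map ι) (by
      rw [hφ, ← hιc, ← hι]
      simp only [Polynomial.map_add, Polynomial.map_sub, Polynomial.map_pow, map_X, map_C])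
    m horbL
    (by
      rw [hiter, ← ha, ← PowerSeries.coeff_zero_eq_constantCoeff_apply, hψ, Polynomial.coeff_coe,
        taylor_coeff_zero]
      rw [Polynomial.map_add, map_C, eval_add, eval_C] at hev
      exact eq_neg_of_add_eq_zero_left hev)
    (by
      rw [hiter, ← ha, ← hψC, ← map_add, hψ]
      exact not_isSquare_taylor_of_odd_rootMultiplicity hq0 hodd)
  rw [← map_iterate_comp_X, ← iterate_comp_right_X] at hsplit hb₀ hsq
  rw [← hιc] at hns hsq
  have key := finrank_splittingField_comp hirr (algebraMap k[X] (RatFunc k) γ)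
    (algebraMap k[X] (RatFunc k) c) ι hsplit hb₀ hns hsq
  have hdeg : ((fun p => p.comp φ)^[m] X).natDegree = 2 ^ m := by
    rw [iterate_comp_right_X, natDegree_iterate_comp, natDegree_X, mul_one, hφ, natDegree_add_C,
      natDegree_pow, natDegree_X_sub_C]
  have hsucc : (fun p => p.comp φ)^[m + 1] X = ((fun p => p.comp φ)^[m] X).comp
      ((X - C (algebraMap k[X] (RatFunc k) γ)) ^ 2 + C (algebraMap k[X] (RatFunc k) c)) := by
    rw [Function.iterate_succ_apply', hφ]
  rw [hsucc, key, hdeg]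

theorem exists_eq_C_mul_sq_of_even_rootMultiplicity {L : Type*} [Field L] [IsAlgClosed L]
    {q : L[X]} (h : ∀ t, Even (q.rootMultiplicity t)) : ∃ (u : L) (s : L[X]), q = C u * s ^ 2 := by
  classical
  obtain ⟨M, hM⟩ : ∃ M : Multiset L, q.roots = 2 • M := by
    refine ⟨∑ a ∈ q.roots.toFinset, (q.roots.count a / 2) • {a}, ?_⟩
    conv_lhs => rw [← Multiset.toFinset_sum_count_nsmul_eq q.roots]
    rw [Finset.smul_sum]
    refine Finset.sum_congr rfl fun a _ => ?_
    rw [smul_smul, Nat.mul_div_cancel' (by rw [count_roots]; exact (h a).two_dvd)]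
  refine ⟨q.leadingCoeff, (M.map fun a => X - C a).prod, ?_⟩
  conv_lhs => rw [(IsAlgClosed.splits q).eq_prod_roots, hM, Multiset.map_nsmul, Multiset.prod_nsmul]

theorem eq_of_add_C_eq_C_mul_sq {L : Type*} [Field L] [CharZero L] {γ s r : L[X]} {a b u v : L}
    (hγ : 0 < γ.natDegree) (hs : γ + C a = C u * s ^ 2) (hr : γ + C b = C v * r ^ 2) : a = b := by
  by_contra hab
  have hdeg : ∀ {a u : L} {s : L[X]}, γ + C a = C u * s ^ 2 →
      s ∣ derivative γ ∧ γ.natDegree = 2 * s.natDegree := by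
    intro a u s h
    have hu : u ≠ 0 := by
      rintro rfl
      have := congrArg natDegree h
      rw [natDegree_add_C, C_0, zero_mul, natDegree_zero] at this
      omega
    constructor
    · have := congrArg derivative h
      rw [derivative_add, derivative_C, add_zero, derivative_C_mul, derivative_sq] at this
      rw [this]
      exact ⟨C u * (C 2 * derivative s), by ring⟩
    · rw [← natDegree_add_C (a := a), h, natDegree_C_mul hu, natDegree_pow]
  obtain ⟨hs1, hs2⟩ := hdeg hs
  obtain ⟨hr1, hr2⟩ := hdeg hr
  have hcop : IsCoprime s r := by
    refine ⟨C (a - b)⁻¹ * C u * s, -(C (a - b)⁻¹ * C v * r), ?_⟩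
    have h1 : C u * s ^ 2 - C v * r ^ 2 = C (a - b) := by
      rw [← hs, ← hr, C_sub]
      ring
    have h2 : C (a - b)⁻¹ * C (a - b) = (1 : L[X]) := by
      rw [← C_mul, inv_mul_cancel₀ (sub_ne_zero.2 hab), C_1]
    linear_combination C (a - b)⁻¹ * h1 + h2
  have hd0 : derivative γ ≠ 0 := by
    intro h
    have := derivative_eq_zero.1 h
    omega
  have hle := natDegree_le_of_dvd (hcop.mul_dvd hs1 hr1) hd0
  have hs0 : s ≠ 0 := by rintro rfl; simp at hs2; omega
  have hr0 : r ≠ 0 := by rintro rfl; simp at hr2; omega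
  rw [natDegree_mul hs0 hr0] at hle
  have hlt := natDegree_derivative_lt hγ.ne'
  omega

theorem injective_iterate_of_infinite {α : Type*} {f : α → α} {x : α}
    (h : (Set.range fun n => f^[n] x).Infinite) : Function.Injective fun n => f^[n] x := by
  have key : ∀ i j, i < j → f^[i] x ≠ f^[j] x := by
    intro i j hij heq
    apply h
    refine ((Set.finite_Iio j).image fun n => f^[n] x).subset ?_
    rintro _ ⟨n, rfl⟩
    induction n using Nat.strong_induction_on with
    | _ n ih =>
      by_cases hn : n < j
      · exact ⟨n, hn, rfl⟩
      · have h1 : f^[n] x = f^[n - j + i] x := by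
          rw [Function.iterate_add_apply, heq, ← Function.iterate_add_apply]
          congr 2
          omega
        simp only [h1]
        exact ih _ (by omega)
  intro i j hij
  rcases lt_trichotomy i j with h1 | h1 | h1
  · exact absurd hij (key i j h1)
  · exact h1
  · exact absurd hij.symm (key j i h1)

/-- Theorem 1 part 3 (isotrivial case): if `φ = (x-γ)²+c` over `K = k(t)` is stable,
post-critically infinite, `h(γ) > 0` and `γ - c` is constant, then the set of `n ≥ 1` for
which `K_n/K_{n-1}` is not maximal has at most `h(γ) - 1` elements. -/
theorem isotrivial_nonmaximal_count (k : Type*) [Field k] [CharZero k] (γ c : Polynomial k)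
    (φ : Polynomial (RatFunc k))
    (hφ : φ = (X - C (algebraMap (Polynomial k) (RatFunc k) γ)) ^ 2
            + C (algebraMap (Polynomial k) (RatFunc k) c))
    (hstable : ∀ n : ℕ, 1 ≤ n →
      Irreducible ((fun p => p.comp φ)^[n] (X : Polynomial (RatFunc k))))
    (hpci : Set.Infinite
      {x : Polynomial k | ∃ n : ℕ, 1 ≤ n ∧ (fun a => (a - γ) ^ 2 + c)^[n] γ = x})
    (hγ : 0 < γ.natDegree)
    (hiso : (γ - c).natDegree = 0) :
    Set.Finite {n : ℕ | 1 ≤ n ∧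
      Module.finrank
        (Polynomial.SplittingField ((fun p => p.comp φ)^[n - 1] (X : Polynomial (RatFunc k))))
        (Polynomial.SplittingField
          (((fun p => p.comp φ)^[n] (X : Polynomial (RatFunc k))).map
            (algebraMap (RatFunc k)
              (Polynomial.SplittingField
                ((fun p => p.comp φ)^[n - 1] (X : Polynomial (RatFunc k)))))))
      ≠ 2 ^ 2 ^ (n - 1)} ∧
    Set.ncard {n : ℕ | 1 ≤ n ∧
      Module.finrank
        (Polynomial.SplittingField ((fun p => p.comp φ)^[n - 1] (X : Polynomial (RatFunc k))))
        (Polynomial.SplittingField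
          (((fun p => p.comp φ)^[n] (X : Polynomial (RatFunc k))).map
            (algebraMap (RatFunc k)
              (Polynomial.SplittingField
                ((fun p => p.comp φ)^[n - 1] (X : Polynomial (RatFunc k)))))))
      ≠ 2 ^ 2 ^ (n - 1)} ≤ γ.natDegree - 1 := by
  obtain ⟨d, hd⟩ := natDegree_eq_zero.1 hiso
  obtain ⟨e, hc⟩ : ∃ e : k, c = γ + C e := ⟨-d, by rw [C_neg, hd]; ring⟩
  have horb : Function.Injective fun i => (fun x : k => x ^ 2 + e)^[i] 0 := by
    apply injective_iterate_of_infinite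
    intro hfin
    apply hpci
    refine (hfin.image fun x => γ + C x).subset ?_
    rintro _ ⟨n, -, rfl⟩
    refine ⟨_, ⟨n, rfl⟩, ?_⟩
    have hs : Function.Semiconj (fun x => γ + C x) (fun x : k => x ^ 2 + e)
        (fun a => (a - γ) ^ 2 + c) := fun x => by
      simp only [hc, C_add, C_pow]
      ring
    simpa using (hs.iterate_right n).eq 0
  set N := {n : ℕ | 1 ≤ n ∧
      Module.finrank
        (Polynomial.SplittingField ((fun p => p.comp φ)^[n - 1] (X : Polynomial (RatFunc k))))
        (Polynomial.SplittingField
          (((fun p => p.comp φ)^[n] (X : Polynomial (RatFunc k))).map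
            (algebraMap (RatFunc k)
              (Polynomial.SplittingField
                ((fun p => p.comp φ)^[n - 1] (X : Polynomial (RatFunc k)))))))
      ≠ 2 ^ 2 ^ (n - 1)} with hN
  have hγL : 0 < (γ.map (algebraMap k (AlgebraicClosure k))).natDegree := by
    rwa [natDegree_map]
  have hsquare : ∀ n ∈ N, ∃ (u : AlgebraicClosure k) (s : (AlgebraicClosure k)[X]),
      γ.map (algebraMap k (AlgebraicClosure k)) +
        C (algebraMap k (AlgebraicClosure k) ((fun x : k => x ^ 2 + e)^[n] 0)) = C u * s ^ 2 := by
    rintro n ⟨hn, hmax⟩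
    obtain ⟨m, rfl⟩ : ∃ m, n = m + 1 := ⟨n - 1, by omega⟩
    rw [← map_C, ← Polynomial.map_add]
    apply exists_eq_C_mul_sq_of_even_rootMultiplicity
    intro t
    by_contra ht
    apply hmax
    refine finrank_eq_of_odd_rootMultiplicity hc horb hφ m ?_ hγ (Nat.not_even_iff_odd.1 ht)
    rcases Nat.eq_zero_or_pos m with rfl | hm
    · exact irreducible_X
    · exact hstable m hm
  have hsub : N.Subsingleton := by
    intro i hi j hj
    obtain ⟨u, s, hs⟩ := hsquare i hi
    obtain ⟨v, r, hr⟩ := hsquare j hj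
    exact horb ((algebraMap k (AlgebraicClosure k)).injective
      (eq_of_add_C_eq_C_mul_sq hγL hs hr))
  refine ⟨hsub.finite, ?_⟩
  rcases hsub.eq_empty_or_singleton with h | ⟨n, h⟩
  · simp [h]
  · rw [h, Set.ncard_singleton]
    obtain ⟨u, s, hs⟩ := hsquare n (by rw [h]; rfl)
    have hle := congrArg natDegree hs
    rw [natDegree_add_C, natDegree_map] at hle
    have hu : u ≠ 0 := by
      rintro rfl
      rw [C_0, zero_mul, natDegree_zero] at hle
      omega
    rw [natDegree_C_mul hu, natDegree_pow] at hle
    omega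
end

section
/- Let F be a field of characteristic different from 2, let γ, c ∈ F, and let φ(x) = (x−γ)² + c ∈ F[x]. Fix n ≥ 2 and assume the iterates φ, φ², …, φ^n are separable and that φ^(n−1) is irreducible over F. Let F_{n−1} and F_n be the splitting fields of φ^(n−1) and φ^n over F. Then [F_n : F_{n−1}] = 2^(2^(n−1)) if and only if φ^n(γ) is not a square in F_{n−1}. -/
open Polynomial IntermediateField

section Kummer

variable {K L : Type*} [Field K] [Field L] [Algebra K L]

theorem exists_eq_add_mul_of_mem_adjoin_sqrt {d : K} {β : L} (hβ : β ^ 2 = algebraMap K L d)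
    {x : L} (hx : x ∈ K⟮β⟯) : ∃ u v : K, x = algebraMap K L u + algebraMap K L v * β := by
  have hint : IsIntegral K β := ⟨X ^ 2 - C d, monic_X_pow_sub_C d two_ne_zero, by simp [hβ]⟩
  rw [← mem_toSubalgebra, adjoin_simple_toSubalgebra_of_isAlgebraic hint.isAlgebraic] at hx
  induction hx using Algebra.adjoin_induction with
  | mem x hx => exact ⟨0, 1, by simp_all⟩
  | algebraMap r => exact ⟨r, 0, by simp⟩
  | add x y _ _ hx hy =>
    obtain ⟨u, v, rfl⟩ := hx
    obtain ⟨u', v', rfl⟩ := hy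
    exact ⟨u + u', v + v', by simp only [map_add]; ring⟩
  | mul x y _ _ hx hy =>
    obtain ⟨u, v, rfl⟩ := hx
    obtain ⟨u', v', rfl⟩ := hy
    refine ⟨u * u' + v * v' * d, u * v' + v * u', ?_⟩
    simp only [map_add, map_mul, ← hβ]
    ring

/-- An element of the base field that becomes a square in `K(β)`, where `β² = d ∈ K`, is a square
in `K` up to a factor `d`. -/
theorem isSquare_or_isSquare_mul_of_mem_adjoin_sqrt (h2 : (2 : K) ≠ 0) {d e : K} {β : L}
    (hβ : β ^ 2 = algebraMap K L d) {x : L} (hx : x ∈ K⟮β⟯) (hxe : x ^ 2 = algebraMap K L e) :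
    IsSquare e ∨ IsSquare (e * d) := by
  have hinj := (algebraMap K L).injective
  by_cases hd : ∃ b : K, algebraMap K L b = β
  · obtain ⟨b, rfl⟩ := hd
    obtain ⟨u, v, rfl⟩ := exists_eq_add_mul_of_mem_adjoin_sqrt hβ hx
    left
    refine ⟨u + v * b, hinj ?_⟩
    rw [← hxe, map_mul, map_add, map_mul, sq]
  obtain ⟨u, v, rfl⟩ := exists_eq_add_mul_of_mem_adjoin_sqrt hβ hx
  have key : algebraMap K L (2 * u * v) * β = algebraMap K L (e - u ^ 2 - v ^ 2 * d) := by
    simp only [map_sub, map_mul, map_pow, ← hxe, ← hβ, map_ofNat]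
    ring
  by_cases huv : 2 * u * v = 0
  · have he : e - u ^ 2 - v ^ 2 * d = 0 := hinj (by rw [← key, huv]; simp)
    rcases mul_eq_zero.mp huv with hu | rfl
    · have hu : u = 0 := by simpa [h2] using hu
      right
      exact ⟨v * d, by subst hu; linear_combination d * he⟩
    · left
      exact ⟨u, by linear_combination he⟩
  · refine absurd ⟨(e - u ^ 2 - v ^ 2 * d) / (2 * u * v), ?_⟩ hd
    rw [map_div₀, ← key, mul_div_cancel_left₀]
    exact (map_ne_zero_iff _ hinj).mpr huv

theorem finrank_adjoin_sqrt_le {d : K} {β : L} (hβ : β ^ 2 = algebraMap K L d) :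
    Module.finrank K K⟮β⟯ ≤ 2 := by
  have hm := monic_X_pow_sub_C d two_ne_zero
  have hint : IsIntegral K β := ⟨X ^ 2 - C d, hm, by simp [hβ]⟩
  rw [adjoin.finrank hint, ← natDegree_X_pow_sub_C (n := 2) (r := d)]
  exact natDegree_le_of_dvd (minpoly.dvd K β (by simp [hβ])) hm.ne_zero

theorem finrank_adjoin_sqrt_s5 {d : K} {β : L} (hβ : β ^ 2 = algebraMap K L d)
    (hd : ¬ IsSquare d) : Module.finrank K K⟮β⟯ = 2 := by
  have hm := monic_X_pow_sub_C d two_ne_zero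
  have hint : IsIntegral K β := ⟨X ^ 2 - C d, hm, by simp [hβ]⟩
  have hirr : Irreducible (X ^ 2 - C d) := (X_pow_sub_C_irreducible_iff_of_prime Nat.prime_two).mpr
    fun b hb => hd ⟨b, by rw [← hb, sq]⟩
  rw [adjoin.finrank hint, ← minpoly.eq_of_irreducible_of_monic hirr (by simp [hβ]) hm,
    natDegree_X_pow_sub_C]

variable {ι : Type*} [DecidableEq ι] {δ : ι → K} {β : ι → L}

theorem restrictScalars_adjoin_image_insert (s : Finset ι) (a : ι) :
    (adjoin K (β '' s))⟮β a⟯.restrictScalars K = adjoin K (β '' (insert a s : Finset ι)) := by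
  rw [adjoin_adjoin_left, Finset.coe_insert, Set.image_insert_eq, Set.insert_eq, Set.union_comm]

theorem finrank_adjoin_image_insert (s : Finset ι) (a : ι) :
    Module.finrank K (adjoin K (β '' (insert a s : Finset ι))) =
      Module.finrank K (adjoin K (β '' s)) *
        Module.finrank (adjoin K (β '' s)) (adjoin K (β '' s))⟮β a⟯ := by
  rw [← restrictScalars_adjoin_image_insert, Module.finrank_mul_finrank]
  rfl

theorem exists_isSquare_mul_prod_of_mem_adjoin (h2 : (2 : K) ≠ 0)
    (s : Finset ι) (hβ : ∀ i ∈ s, β i ^ 2 = algebraMap K L (δ i)) {e : K} {x : L}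
    (hx : x ∈ adjoin K (β '' s)) (hxe : x ^ 2 = algebraMap K L e) :
    ∃ t ⊆ s, IsSquare (e * ∏ i ∈ t, δ i) := by
  induction s using Finset.induction_on generalizing e x with
  | empty =>
    simp only [Finset.coe_empty, Set.image_empty, adjoin_empty, mem_bot] at hx
    obtain ⟨y, rfl⟩ := hx
    exact ⟨∅, subset_rfl, y, (algebraMap K L).injective (by simp [← hxe, sq])⟩
  | insert a s ha ih =>
    have hβa := hβ a (Finset.mem_insert_self a s)
    have hβs := fun i hi => hβ i (Finset.mem_insert_of_mem (a := i) (b := a) (s := s) hi)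
    set M := adjoin K (β '' s)
    rw [← restrictScalars_adjoin_image_insert, mem_restrictScalars] at hx
    have h2M : (2 : M) ≠ 0 := by
      rw [← map_ofNat (algebraMap K M) 2]
      exact (map_ne_zero_iff _ (algebraMap K M).injective).mpr h2
    rcases isSquare_or_isSquare_mul_of_mem_adjoin_sqrt h2M (d := algebraMap K M (δ a))
      (e := algebraMap K M e) hβa hx hxe with ⟨y, hy⟩ | ⟨y, hy⟩
    · obtain ⟨t, ht, h⟩ := ih hβs y.2 (e := e) (by
        rw [sq]; exact (congrArg Subtype.val hy).symm)
      exact ⟨t, ht.trans (Finset.subset_insert a s), h⟩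
    · obtain ⟨t, ht, h⟩ := ih hβs y.2 (e := e * δ a) (by
        rw [sq, map_mul]; exact (congrArg Subtype.val hy).symm)
      refine ⟨insert a t, Finset.insert_subset_insert a ht, ?_⟩
      rwa [Finset.prod_insert fun h => ha (ht h), ← mul_assoc]

theorem finrank_adjoin_sqrts_le (s : Finset ι)
    (hβ : ∀ i ∈ s, β i ^ 2 = algebraMap K L (δ i)) :
    Module.finrank K (adjoin K (β '' s)) ≤ 2 ^ s.card := by
  induction s using Finset.induction_on with
  | empty =>
    rw [Finset.coe_empty, Set.image_empty, adjoin_empty, IntermediateField.finrank_bot,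
      Finset.card_empty, pow_zero]
  | insert a s ha ih =>
    have hβa := hβ a (Finset.mem_insert_self a s)
    have hβs := fun i hi => hβ i (Finset.mem_insert_of_mem (a := i) (b := a) (s := s) hi)
    rw [finrank_adjoin_image_insert, Finset.card_insert_of_notMem ha, pow_succ]
    exact Nat.mul_le_mul (ih hβs)
      (finrank_adjoin_sqrt_le (d := algebraMap K (adjoin K (β '' s)) (δ a)) hβa)

theorem finrank_adjoin_sqrts_s5 (h2 : (2 : K) ≠ 0) (s : Finset ι)
    (hβ : ∀ i ∈ s, β i ^ 2 = algebraMap K L (δ i))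
    (hs : ∀ t ⊆ s, t.Nonempty → ¬ IsSquare (∏ i ∈ t, δ i)) :
    Module.finrank K (adjoin K (β '' s)) = 2 ^ s.card := by
  induction s using Finset.induction_on with
  | empty => simp
  | insert a s ha ih =>
    have hβa := hβ a (Finset.mem_insert_self a s)
    have hβs := fun i hi => hβ i (Finset.mem_insert_of_mem (a := i) (b := a) (s := s) hi)
    rw [finrank_adjoin_image_insert, Finset.card_insert_of_notMem ha, pow_succ,
      ih hβs fun t ht => hs t (ht.trans (Finset.subset_insert a s)),
      finrank_adjoin_sqrt_s5 (d := algebraMap K (adjoin K (β '' s)) (δ a)) hβa]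
    rintro ⟨y, hy⟩
    obtain ⟨t, ht, h⟩ := exists_isSquare_mul_prod_of_mem_adjoin h2 s hβs y.2 (e := δ a) (by
      rw [sq]; exact (congrArg Subtype.val hy).symm)
    rw [← Finset.prod_insert fun h => ha (ht h)] at h
    exact hs _ (Finset.insert_subset_insert a ht) (Finset.insert_nonempty a t) h

theorem finrank_adjoin_sqrts_lt (s : Finset ι)
    (hβ : ∀ i ∈ s, β i ^ 2 = algebraMap K L (δ i)) (hδ : ∀ i ∈ s, δ i ≠ 0)
    (hs : s.Nonempty) (hsq : IsSquare (∏ i ∈ s, δ i)) :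
    Module.finrank K (adjoin K (β '' s)) < 2 ^ s.card := by
  obtain ⟨a, ha⟩ := hs
  obtain ⟨y, hy⟩ := hsq
  set M := adjoin K (β '' (s.erase a : Finset ι)) with hM
  have hprod : ∏ i ∈ s.erase a, β i ∈ M :=
    prod_mem fun i hi => subset_adjoin K _ ⟨i, hi, rfl⟩
  have hne : ∏ i ∈ s.erase a, β i ≠ 0 := Finset.prod_ne_zero_iff.mpr fun i hi h0 =>
    hδ i (Finset.mem_of_mem_erase hi) ((algebraMap K L).injective
      (by rw [← hβ i (Finset.mem_of_mem_erase hi), h0, map_zero, sq, zero_mul]))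
  have hsq : (β a * ∏ i ∈ s.erase a, β i) ^ 2 = algebraMap K L y ^ 2 := by
    rw [Finset.mul_prod_erase s β ha, ← Finset.prod_pow, Finset.prod_congr rfl hβ,
      ← map_prod, hy, map_mul, sq]
  have hmem : β a * ∏ i ∈ s.erase a, β i ∈ M := by
    rcases sq_eq_sq_iff_eq_or_eq_neg.mp hsq with h | h <;> rw [h]
    · exact M.algebraMap_mem y
    · exact neg_mem (M.algebraMap_mem y)
  have hβa : β a ∈ M := by
    rw [← mul_div_cancel_right₀ (β a) hne]
    exact div_mem hmem hprod
  have hle : adjoin K (β '' s) = M := by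
    rw [← Finset.insert_erase ha, ← restrictScalars_adjoin_image_insert, ← hM,
      (adjoin_simple_eq_bot_iff (F := M) (α := β a)).mpr ⟨⟨β a, hβa⟩, rfl⟩]
    exact restrictScalars_bot_eq_self M
  rw [hle]
  refine (finrank_adjoin_sqrts_le _ fun i hi => hβ i (Finset.mem_of_mem_erase hi)).trans_lt ?_
  exact Nat.pow_lt_pow_right one_lt_two (Finset.card_erase_lt_of_mem ha)

end Kummer

section FixedSubset

open scoped Pointwise symmDiff

variable {G ι K : Type*} [Group G] [Field K] [MulAction G ι] [MulSemiringAction G K]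
  [DecidableEq ι] {δ : ι → K}

theorem isSquare_prod_symmDiff {S T : Finset ι} (hδ : ∀ i ∈ S, δ i ≠ 0)
    (hS : IsSquare (∏ i ∈ S, δ i)) (hT : IsSquare (∏ i ∈ T, δ i)) :
    IsSquare (∏ i ∈ S ∆ T, δ i) := by
  have hne : ∏ i ∈ S ∩ T, δ i ≠ 0 :=
    Finset.prod_ne_zero_iff.mpr fun i hi => hδ i (Finset.mem_inter.mp hi).1
  have h : ∏ i ∈ S ∆ T, δ i = (∏ i ∈ S, δ i) * (∏ i ∈ T, δ i) / (∏ i ∈ S ∩ T, δ i) ^ 2 := by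
    rw [eq_div_iff (pow_ne_zero 2 hne), ← Finset.prod_union_inter, sq, ← mul_assoc,
      ← Finset.prod_union]
    · congr 2
      ext i
      simp only [Finset.mem_union, Finset.mem_symmDiff, Finset.mem_inter]
      tauto
    · rw [Finset.disjoint_left]
      intro i
      simp only [Finset.mem_symmDiff, Finset.mem_inter]
      tauto
  rw [h]
  exact (hS.mul hT).div (IsSquare.sq _)

theorem isSquare_prod_smul (hsmul : ∀ (g : G) (i : ι), δ (g • i) = g • δ i) (g : G) {S : Finset ι}
    (hS : IsSquare (∏ i ∈ S, δ i)) : IsSquare (∏ i ∈ g • S, δ i) := by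
  rw [← Finset.image_smul, Finset.prod_image (MulAction.injective g).injOn]
  simp_rw [hsmul]
  rw [← Finset.smul_prod']
  exact hS.map (MulSemiringAction.toRingHom G K g)

/-- If a `2`-group permutes the family `δ` transitively and some nonempty subfamily has square
product, then the whole family has square product. -/
theorem IsPGroup.isSquare_prod_of_isSquare_prod_subset (hG : IsPGroup 2 G)
    (hsmul : ∀ (g : G) (i : ι), δ (g • i) = g • δ i) {R : Finset ι} (hδ : ∀ i ∈ R, δ i ≠ 0)
    (hR : ∀ g : G, g • R = R) (htrans : ∀ i ∈ R, ∀ j ∈ R, ∃ g : G, g • i = j)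
    {T : Finset ι} (hTR : T ⊆ R) (hT : T.Nonempty) (hsq : IsSquare (∏ i ∈ T, δ i)) :
    IsSquare (∏ i ∈ R, δ i) := by
  classical
  let V : SubMulAction G (Finset ι) :=
    { carrier := {S | S ⊆ R ∧ IsSquare (∏ i ∈ S, δ i)}
      smul_mem' := fun g S hS =>
        ⟨by rw [← hR g]; exact Finset.smul_finset_subset_smul_finset hS.1,
          isSquare_prod_smul hsmul g hS.2⟩ }
  have hfin : Finite V := Set.Finite.to_subtype
    (R.powerset.finite_toSet.subset fun S hS => Finset.mem_coe.mpr (Finset.mem_powerset.mpr hS.1))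
  have := Fintype.ofFinite V
  have hmem : ∀ S : V, S.1 ∆ T ∈ V := fun S =>
    ⟨fun i hi => by
      rcases Finset.mem_symmDiff.mp hi with h | h
      exacts [S.2.1 h.1, hTR h.1],
      isSquare_prod_symmDiff (fun i hi => hδ i (S.2.1 hi)) S.2.2 hsq⟩
  have heven : 2 ∣ Nat.card V := by
    rw [Nat.card_eq_fintype_card, ← ZMod.natCast_eq_zero_iff, ← Finset.card_univ,
      Finset.cast_card]
    refine Finset.sum_ninvolution (fun S : V => ⟨S.1 ∆ T, hmem S⟩) (fun _ => by decide)
      (fun S _ h => ?_) (fun _ => Finset.mem_univ _)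
      fun S => Subtype.ext (symmDiff_symmDiff_cancel_right _ _)
    exact hT.ne_empty (symmDiff_eq_left.mp (congrArg Subtype.val h))
  have hempty : (⟨∅, Finset.empty_subset R, by simp⟩ : V) ∈ MulAction.fixedPoints G V :=
    fun g => Subtype.ext (Finset.smul_finset_empty g)
  obtain ⟨S, hS, hne⟩ := hG.exists_fixed_point_of_prime_dvd_card_of_fixed_point V heven hempty
  obtain ⟨i, hi⟩ : S.1.Nonempty :=
    Finset.nonempty_iff_ne_empty.mpr fun h => hne (Subtype.ext h.symm)
  have hSR : S.1 = R := S.2.1.antisymm fun j hj => by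
    obtain ⟨g, rfl⟩ := htrans i (S.2.1 hi) j hj
    have hg : g • S.1 = S.1 := congrArg Subtype.val (hS g)
    rw [← hg]
    exact Finset.smul_mem_smul_finset hi
  exact hSR ▸ S.2.2

end FixedSubset

section Iterates

variable {F : Type*} [Field F]

theorem natDegree_comp_shifted_sq (f : F[X]) (γ c : F) :
    (f.comp ((X - C γ) ^ 2 + C c)).natDegree = f.natDegree * 2 := by
  rw [natDegree_comp, natDegree_add_C, natDegree_pow, natDegree_X_sub_C, mul_one]

theorem monic_shifted_sq_add_C (γ c : F) : ((X - C γ) ^ 2 + C c).Monic :=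
  ((monic_X_sub_C γ).pow 2).add_of_left <| by
    rw [degree_pow, degree_X_sub_C]
    exact degree_C_le.trans_lt (by norm_num)

theorem natDegree_iterate_comp_shifted_sq (γ c : F) (m : ℕ) :
    ((fun p => p.comp ((X - C γ) ^ 2 + C c))^[m] (X : F[X])).natDegree = 2 ^ m := by
  induction m with
  | zero => simp
  | succ m ih => rw [Function.iterate_succ_apply', natDegree_comp_shifted_sq, ih, pow_succ]

theorem monic_iterate_comp_shifted_sq (γ c : F) (m : ℕ) :
    ((fun p => p.comp ((X - C γ) ^ 2 + C c))^[m] (X : F[X])).Monic := by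
  induction m with
  | zero => exact monic_X
  | succ m ih =>
    rw [Function.iterate_succ_apply']
    refine ih.comp (monic_shifted_sq_add_C γ c) ?_
    rw [natDegree_add_C, natDegree_pow, natDegree_X_sub_C]
    norm_num

variable {K : Type*} [Field K] [Algebra F K]

theorem aeval_comp_shifted_sq (f : F[X]) (γ c : F) (x : K) :
    aeval x (f.comp ((X - C γ) ^ 2 + C c)) =
      aeval ((x - algebraMap F K γ) ^ 2 + algebraMap F K c) f := by
  simp [aeval_comp]

theorem algEquiv_pow_two_pow_apply_of_isRoot_iterate (γ c : F) (σ : Gal(K/F)) (m : ℕ) {x : K}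
    (hx : aeval x ((fun p => p.comp ((X - C γ) ^ 2 + C c))^[m] (X : F[X])) = 0) :
    (σ ^ 2 ^ m) x = x := by
  induction m generalizing x with
  | zero =>
    have hx : x = 0 := by simpa using hx
    simp [hx]
  | succ m ih =>
    rw [Function.iterate_succ_apply', aeval_comp_shifted_sq] at hx
    have h := ih hx
    rw [pow_succ, pow_mul]
    set τ := σ ^ 2 ^ m
    simp only [map_add, map_pow, map_sub, AlgEquiv.commutes, add_left_inj] at h
    rw [sq τ, AlgEquiv.mul_apply]
    rcases sq_eq_sq_iff_eq_or_eq_neg.mp h with h | h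
    · rw [sub_left_inj.mp h, sub_left_inj.mp h]
    · have hτ : τ x = algebraMap F K γ + algebraMap F K γ - x := by linear_combination h
      rw [hτ, map_sub, hτ, map_add, AlgEquiv.commutes]
      ring

theorem isPGroup_two_gal_iterate (γ c : F) (m : ℕ)
    [IsSplittingField F K ((fun p => p.comp ((X - C γ) ^ 2 + C c))^[m] (X : F[X]))] :
    IsPGroup 2 Gal(K/F) := by
  refine fun σ => ⟨m, ?_⟩
  have h : ((σ ^ 2 ^ m : Gal(K/F)) : K →ₐ[F] K) = AlgHom.id F K :=
    AlgHom.ext_of_adjoin_eq_top (IsSplittingField.adjoin_rootSet K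
      ((fun p => p.comp ((X - C γ) ^ 2 + C c))^[m] (X : F[X]))) fun x hx =>
      algEquiv_pow_two_pow_apply_of_isRoot_iterate γ c σ m (mem_rootSet.mp hx).2
  exact AlgEquiv.ext fun x => DFunLike.congr_fun h x

end Iterates

section SplittingFieldComp

open scoped Pointwise

variable {F K L : Type*} [Field F] [Field K] [Field L] [Algebra F K] [Algebra K L]

theorem prod_root_sub_eq_eval {f : F[X]} (hf : f.Monic)
    (hsep : f.Separable) (hsplits : (f.map (algebraMap F K)).Splits) (heven : Even f.natDegree)
    (c : F) :
    ∏ a ∈ (f.rootSet K).toFinset, (a - algebraMap F K c) = algebraMap F K (f.eval c) := by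
  classical
  have hcard : (f.rootSet K).toFinset.card = f.natDegree := by
    rw [Set.toFinset_card, card_rootSet_eq_natDegree hsep hsplits]
  have hroots : (f.rootSet K).toFinset = (f.map (algebraMap F K)).roots.toFinset := by
    rw [← Finset.coe_inj, Set.coe_toFinset, rootSet_def, aroots_def]
  have h : ∏ a ∈ (f.rootSet K).toFinset, (algebraMap F K c - a) = algebraMap F K (f.eval c) := by
    rw [← eval₂_at_apply, ← eval_map, hsplits.eval_eq_prod_roots_of_monic (hf.map _),
      hroots, ← Finset.prod_map_val, Multiset.toFinset_val, (nodup_roots hsep.map).dedup]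
  rw [← h, ← one_mul (∏ a ∈ (f.rootSet K).toFinset, (algebraMap F K c - a)),
    ← heven.neg_one_pow, ← hcard, ← Finset.prod_neg]
  simp

theorem eval_ne_zero_of_separable_comp {f : F[X]} {γ c : F}
    (hsep : (f.comp ((X - C γ) ^ 2 + C c)).Separable) : f.eval c ≠ 0 := fun h => by
  refine hsep.eval₂_derivative_ne_zero (RingHom.id F) (x := γ) ?_ ?_ <;>
  simp [derivative_comp, derivative_pow, eval₂_id, h]

theorem exists_sq_eq_of_splits_comp [Algebra F L] [IsScalarTower F K L] {f : F[X]} {γ c : F}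
    (hf : f ≠ 0)
    (hsplits : ((f.comp ((X - C γ) ^ 2 + C c)).map (algebraMap F L)).Splits) {a : K}
    (ha : aeval a f = 0) : ∃ b : L, b ^ 2 = algebraMap K L (a - algebraMap F K c) := by
  set q : L[X] := (X - C (algebraMap F L γ)) ^ 2 + C (algebraMap F L c)
  have hq : ((X - C γ) ^ 2 + C c).map (algebraMap F L) = q := by simp [q]
  have hroot : X - C (algebraMap K L a) ∣ f.map (algebraMap F L) := by
    rw [dvd_iff_isRoot, IsRoot, eval_map_algebraMap, aeval_algebraMap_apply, ha, map_zero]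
  have hdvd : q - C (algebraMap K L a) ∣
      (f.comp ((X - C γ) ^ 2 + C c)).map (algebraMap F L) := by
    rw [map_comp, hq]
    obtain ⟨g, hg⟩ := hroot
    exact ⟨g.comp q, by rw [hg, mul_comp, sub_comp, X_comp, C_comp]⟩
  have hne : (f.comp ((X - C γ) ^ 2 + C c)).map (algebraMap F L) ≠ 0 := by
    rw [map_comp, hq]
    refine fun h => (map_ne_zero (f := algebraMap F L) hf) ?_
    rcases comp_eq_zero_iff.mp h with h | h
    · exact h
    · have := congrArg natDegree h.2
      rw [natDegree_add_C, natDegree_pow, natDegree_X_sub_C, natDegree_C] at this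
      omega
  have hdeg : (q - C (algebraMap K L a)).natDegree = 2 := by
    rw [natDegree_sub_C, natDegree_add_C, natDegree_pow, natDegree_X_sub_C, mul_one]
  obtain ⟨x, hx⟩ := (hsplits.of_dvd hne hdvd).exists_eval_eq_zero
    fun h => two_ne_zero (hdeg.symm.trans (natDegree_eq_of_degree_eq_some h))
  refine ⟨x - algebraMap F L γ, ?_⟩
  simp only [q, eval_sub, eval_add, eval_pow, eval_X, eval_C] at hx
  rw [map_sub, ← IsScalarTower.algebraMap_apply]
  linear_combination hx

theorem adjoin_sqrts_eq_top [Algebra F L] [IsScalarTower F K L] {f : F[X]} {γ c : F}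
    [IsSplittingField F K f]
    [IsSplittingField K L ((f.comp ((X - C γ) ^ 2 + C c)).map (algebraMap F K))]
    {β : K → L} (hβ : ∀ a ∈ f.rootSet K, β a ^ 2 = algebraMap K L (a - algebraMap F K c)) :
    adjoin K (β '' f.rootSet K) = ⊤ := by
  set g := f.comp ((X - C γ) ^ 2 + C c)
  have hfsplits : (f.map (algebraMap F K)).Splits := IsSplittingField.splits K f
  refine eq_top_iff.mpr fun y _ => ?_
  have hy : y ∈ Algebra.adjoin K ((g.map (algebraMap F K)).rootSet L) := by
    rw [IsSplittingField.adjoin_rootSet L (g.map (algebraMap F K))]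
    trivial
  refine (Algebra.adjoin_le (S := (adjoin K (β '' f.rootSet K)).toSubalgebra) fun x hx => ?_) hy
  rw [SetLike.mem_coe, mem_toSubalgebra]
  set M := adjoin K (β '' f.rootSet K)
  rw [mem_rootSet] at hx
  obtain ⟨hg, hx⟩ := hx
  have hf : f ≠ 0 := by
    rintro rfl
    simp [g] at hg
  rw [aeval_map_algebraMap, aeval_comp_shifted_sq] at hx
  have hmem : (x - algebraMap F L γ) ^ 2 + algebraMap F L c ∈ f.rootSet L :=
    mem_rootSet.mpr ⟨hf, hx⟩
  rw [← hfsplits.image_rootSet_algebraMap] at hmem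
  obtain ⟨a, ha, hax⟩ := hmem
  have hsq : (x - algebraMap F L γ) ^ 2 = β a ^ 2 := by
    rw [hβ a ha, map_sub, ← IsScalarTower.algebraMap_apply]
    linear_combination -hax
  have hβa : β a ∈ M := subset_adjoin K _ ⟨a, ha, rfl⟩
  have hγ : algebraMap F L γ ∈ M := by
    rw [IsScalarTower.algebraMap_apply F K L]
    exact M.algebraMap_mem _
  rw [← sub_add_cancel x (algebraMap F L γ)]
  refine add_mem ?_ hγ
  rcases sq_eq_sq_iff_eq_or_eq_neg.mp hsq with h | h <;> rw [h]
  exacts [hβa, neg_mem hβa]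

theorem finrank_splittingField_comp_shifted_sq_iff (h2 : (2 : F) ≠ 0) {f : F[X]} {γ c : F}
    (hf : f.Monic) (hirr : Irreducible f) (hsep : f.Separable) (heven : Even f.natDegree)
    (hsep' : (f.comp ((X - C γ) ^ 2 + C c)).Separable)
    [IsSplittingField F K f] (hG : IsPGroup 2 Gal(K/F))
    [IsSplittingField K L ((f.comp ((X - C γ) ^ 2 + C c)).map (algebraMap F K))] :
    Module.finrank K L = 2 ^ f.natDegree ↔
      ¬ IsSquare (algebraMap F K ((f.comp ((X - C γ) ^ 2 + C c)).eval γ)) := by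
  classical
  let _ : Algebra F L := ((algebraMap K L).comp (algebraMap F K)).toAlgebra
  have : IsScalarTower F K L := .of_algebraMap_eq fun _ => rfl
  have hnormal : Normal F K := Normal.of_isSplittingField f
  have hsplits : (f.map (algebraMap F K)).Splits := IsSplittingField.splits K f
  have hsplitsL : ((f.comp ((X - C γ) ^ 2 + C c)).map (algebraMap F L)).Splits := by
    have := IsSplittingField.splits L ((f.comp ((X - C γ) ^ 2 + C c)).map (algebraMap F K))
    rwa [Polynomial.map_map] at this
  set R := (f.rootSet K).toFinset with hR
  have hRcoe : (R : Set K) = f.rootSet K := Set.coe_toFinset _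
  have hmem : ∀ {a}, a ∈ R ↔ aeval a f = 0 := by
    intro a
    rw [hR, Set.mem_toFinset, mem_rootSet, and_iff_right hf.ne_zero]
  have hcard : R.card = f.natDegree := by
    rw [Set.toFinset_card, card_rootSet_eq_natDegree hsep hsplits]
  have hprod := prod_root_sub_eq_eval hf hsep hsplits heven c
  have hc := eval_ne_zero_of_separable_comp hsep'
  have heval : (f.comp ((X - C γ) ^ 2 + C c)).eval γ = f.eval c := by simp
  have hδ : ∀ a ∈ R, a - algebraMap F K c ≠ 0 := by
    rw [← Finset.prod_ne_zero_iff, hprod]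
    exact (map_ne_zero_iff _ (algebraMap F K).injective).mpr hc
  have hβ : ∀ a, ∃ b : L, a ∈ R → b ^ 2 = algebraMap K L (a - algebraMap F K c) := fun a => by
    by_cases ha : a ∈ R
    · obtain ⟨b, hb⟩ := exists_sq_eq_of_splits_comp hf.ne_zero hsplitsL (hmem.mp ha)
      exact ⟨b, fun _ => hb⟩
    · exact ⟨0, fun h => absurd h ha⟩
  choose β hβ using hβ
  have htop : adjoin K (β '' R) = ⊤ := by
    rw [hRcoe]
    exact adjoin_sqrts_eq_top (γ := γ) (c := c) fun a ha => hβ a (by rwa [← hRcoe] at ha)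
  have hfinrank : Module.finrank K L = Module.finrank K (adjoin K (β '' R)) := by
    rw [htop, IntermediateField.finrank_top']
  have hne : R.Nonempty := Finset.card_pos.mp (hcard ▸ hirr.natDegree_pos)
  rw [heval, ← hprod, hfinrank, ← hcard]
  constructor
  · exact fun h hsq => (finrank_adjoin_sqrts_lt R hβ hδ hne hsq).ne h
  · intro hsq
    have h2K : (2 : K) ≠ 0 := by
      rw [← map_ofNat (algebraMap F K) 2]
      exact (map_ne_zero_iff _ (algebraMap F K).injective).mpr h2
    refine finrank_adjoin_sqrts_s5 h2K R hβ fun T hTR hT hTsq => hsq ?_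
    refine hG.isSquare_prod_of_isSquare_prod_subset (δ := fun a => a - algebraMap F K c)
      (fun σ a => ?_) hδ (fun σ => ?_) (fun a ha b hb => ?_) hTR hT hTsq
    · simp [AlgEquiv.smul_def]
    · refine Finset.eq_of_subset_of_card_le (fun x hx => ?_) (by rw [Finset.card_smul_finset])
      obtain ⟨a, ha, rfl⟩ := Finset.mem_smul_finset.mp hx
      rw [hmem] at ha ⊢
      rw [AlgEquiv.smul_def, ← AlgEquiv.coe_toAlgHom, aeval_algHom_apply, ha, map_zero]
    · refine minpoly.exists_algEquiv_of_root (Normal.isIntegral hnormal b).isAlgebraic ?_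
      rw [← minpoly.eq_of_irreducible_of_monic hirr (hmem.mp hb) hf]
      exact hmem.mp ha

end SplittingFieldComp

/-- Stoll's Lemma (Lemma 1): for `φ = (x-γ)²+c` over a field `F` of characteristic ≠ 2,
with `φ, …, φ^n` separable and `φ^(n-1)` irreducible, the extension `F_n/F_{n-1}` of
splitting fields is maximal (degree `2^(2^(n-1))`) iff `φ^n(γ)` is not a square in `F_{n-1}`. -/
theorem stoll_lemma (F : Type*) [Field F] (hchar : ringChar F ≠ 2) (γ c : F)
    (φ : Polynomial F)
    (hφ : φ = (X - C γ) ^ 2 + C c)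
    (n : ℕ) (hn : 2 ≤ n)
    (hsep : ∀ m : ℕ, 1 ≤ m → m ≤ n → ((fun p => p.comp φ)^[m] (X : Polynomial F)).Separable)
    (hirr : Irreducible ((fun p => p.comp φ)^[n - 1] (X : Polynomial F))) :
    Module.finrank
      (Polynomial.SplittingField ((fun p => p.comp φ)^[n - 1] (X : Polynomial F)))
      (Polynomial.SplittingField
        (((fun p => p.comp φ)^[n] (X : Polynomial F)).map
          (algebraMap F
            (Polynomial.SplittingField ((fun p => p.comp φ)^[n - 1] (X : Polynomial F))))))
      = 2 ^ 2 ^ (n - 1)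
    ↔ ¬ IsSquare
        (algebraMap F
          (Polynomial.SplittingField ((fun p => p.comp φ)^[n - 1] (X : Polynomial F)))
          (Polynomial.eval γ ((fun p => p.comp φ)^[n] (X : Polynomial F)))) := by
  subst hφ
  have hdeg := natDegree_iterate_comp_shifted_sq γ c (n - 1)
  have hcomp : (fun p => p.comp ((X - C γ) ^ 2 + C c))^[n] (X : F[X]) =
      ((fun p => p.comp ((X - C γ) ^ 2 + C c))^[n - 1] X).comp ((X - C γ) ^ 2 + C c) := by
    rw [← Function.iterate_succ_apply' (fun p : F[X] => p.comp ((X - C γ) ^ 2 + C c)),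
      Nat.succ_eq_add_one, Nat.sub_add_cancel (by omega)]
  have hsep' := hsep n (by omega) le_rfl
  rw [hcomp] at hsep' ⊢
  rw [← hdeg]
  refine finrank_splittingField_comp_shifted_sq_iff (Ring.two_ne_zero hchar)
    (monic_iterate_comp_shifted_sq γ c (n - 1)) hirr (hsep (n - 1) (by omega) (by omega)) ?_ hsep'
    (isPGroup_two_gal_iterate γ c (n - 1))
  rw [hdeg]
  exact even_two.pow_of_ne_zero (by omega)
end

section
/- Let k be a field, let γ, c ∈ k[t] with deg γ ≠ deg c, and let φ(x) = (x−γ)² + c. Then for every m ≥ 2, the polynomial φ^m(γ) ∈ k[t] has degree exactly 2^(m−1) · max{deg γ, deg c}. -/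
open Polynomial

theorem natDegree_sq_add_of_lt {R : Type*} [Semiring R] [NoZeroDivisors R] {p c : Polynomial R}
    (h : c.natDegree < 2 * p.natDegree) : (p ^ 2 + c).natDegree = 2 * p.natDegree := by
  rw [natDegree_add_eq_left_of_natDegree_lt (by rwa [natDegree_pow]), natDegree_pow]

theorem natDegree_sub_eq_max_of_ne {R : Type*} [Ring R] {p q : Polynomial R}
    (h : p.natDegree ≠ q.natDegree) : (p - q).natDegree = max p.natDegree q.natDegree := by
  rcases h.lt_or_gt with h | h
  · rw [natDegree_sub_eq_right_of_natDegree_lt h, max_eq_right h.le]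
  · rw [natDegree_sub_eq_left_of_natDegree_lt h, max_eq_left h.le]

/-- Lemma 2 part 1(a): if `h(γ) ≠ h(c)` then `h(φ^m(γ)) = 2^(m-1)·h(φ)` for all `m ≥ 2`,
where `φ(a) = (a-γ)² + c` acts on `k[t]` and `h` is the degree. -/
theorem height_critical_orbit_ne (k : Type*) [Field k] (γ c : Polynomial k)
    (hdeg : γ.natDegree ≠ c.natDegree) :
    ∀ m : ℕ, 2 ≤ m →
      ((fun a => (a - γ) ^ 2 + c)^[m] γ).natDegree
        = 2 ^ (m - 1) * max γ.natDegree c.natDegree := by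
  intro m hm
  induction m, hm using Nat.le_induction with
  | base =>
    have hsub := natDegree_sub_eq_max_of_ne hdeg.symm
    have hφ : (fun a => (a - γ) ^ 2 + c)^[2] γ = (c - γ) ^ 2 + c := by simp
    rw [hφ, natDegree_sq_add_of_lt (by omega), hsub, max_comm, pow_one]
  | succ n hn ih =>
    rw [Function.iterate_succ_apply']
    set a := (fun a => (a - γ) ^ 2 + c)^[n] γ
    have hpow : 2 ≤ 2 ^ (n - 1) := Nat.le_self_pow (by omega) 2
    have hle := Nat.mul_le_mul_right (max γ.natDegree c.natDegree) hpow
    have hsub : (a - γ).natDegree = a.natDegree :=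
      natDegree_sub_eq_left_of_natDegree_lt (by omega)
    rw [natDegree_sq_add_of_lt (by omega), hsub, ih, ← mul_assoc, ← pow_succ',
      Nat.sub_add_cancel (by omega), Nat.add_sub_cancel]
end

section
/- Let R be a commutative ring, let γ, c ∈ R, and let φ : R → R be the map a ↦ (a−γ)² + c. If p ∈ R divides both φ^m(γ) and φ^n(γ) for integers 1 ≤ m < n, then p divides φ^(n−m)(0). -/
/-- If `f` preserves congruence modulo `p`, then so do all its iterates. -/
theorem dvd_iterate_sub_iterate {R : Type*} [CommRing R] {p : R} {f : R → R}
    (hf : ∀ a b, p ∣ a - b → p ∣ f a - f b) (k : ℕ) {a b : R} (h : p ∣ a - b) :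
    p ∣ f^[k] a - f^[k] b := by
  induction k generalizing a b with
  | zero => exact h
  | succ k ih => exact ih (hf a b h)

/-- Divisibility refinement: if `p` divides both `φ^m(γ)` and `φ^n(γ)` with `1 ≤ m < n`,
where `φ(a) = (a-γ)² + c` on a commutative ring `R`, then `p` divides `φ^(n-m)(0)`. -/
theorem dvd_orbit_zero (R : Type*) [CommRing R] (γ c p : R) (m n : ℕ)
    (hm : 1 ≤ m) (hmn : m < n)
    (h1 : p ∣ (fun a => (a - γ) ^ 2 + c)^[m] γ)
    (h2 : p ∣ (fun a => (a - γ) ^ 2 + c)^[n] γ) :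
    p ∣ (fun a => (a - γ) ^ 2 + c)^[n - m] 0 := by
  have hf : ∀ a b : R, p ∣ a - b → p ∣ ((a - γ) ^ 2 + c) - ((b - γ) ^ 2 + c) := by
    rintro a b ⟨d, hd⟩
    exact ⟨d * (a + b - 2 * γ), by linear_combination (a + b - 2 * γ) * hd⟩
  have h := dvd_iterate_sub_iterate (f := fun a => (a - γ) ^ 2 + c) hf (n - m)
    (a := (fun a => (a - γ) ^ 2 + c)^[m] γ) (b := 0) (by rwa [sub_zero])
  rw [← Function.iterate_add_apply, Nat.sub_add_cancel hmn.le] at h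
  exact (dvd_sub_right h2).mp h
end

section
/- Let k be a field of characteristic zero, let f ∈ k[t] be a non-constant polynomial, and let φ_f : k[t] → k[t] be the map a ↦ a² + f. Then for every n ≥ 2, the polynomial φ_f^n(0) is not a square in k[t]; that is, there is no g ∈ k[t] with g² = φ_f^n(0). -/
open Polynomial

/-- Every positive iterate of `0` under `a ↦ a² + f` is a non-zero multiple of `f`. -/
theorem exists_iterate_sq_add_eq_mul {R : Type*} [CommRing R] [Nontrivial R] {f : R}
    (hf : ¬ IsUnit f) (m : ℕ) :
    ∃ h : R, h ≠ 0 ∧ (fun a => a ^ 2 + f)^[m + 1] 0 = f * h := by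
  induction m with
  | zero => exact ⟨1, one_ne_zero, by simp⟩
  | succ m ih =>
    obtain ⟨h, -, hm⟩ := ih
    refine ⟨f * h ^ 2 + 1, fun h0 => hf (.of_mul_eq_one (-h ^ 2) ?_), ?_⟩
    · linear_combination -h0
    · rw [Function.iterate_succ_apply', hm]
      ring

/-- If `1 + 2 * u * h` is a unit of `k[t]` and `h ≠ 0`, then `u` is constant. -/
theorem natDegree_eq_zero_of_isUnit_one_add_two_mul {k : Type*} [Field k] [NeZero (2 : k)]
    {u h : k[X]} (hh : h ≠ 0) (hu : IsUnit (1 + 2 * u * h)) : u.natDegree = 0 := by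
  rcases eq_or_ne u 0 with rfl | hu0
  · exact natDegree_zero
  have h2 : C (2 : k) ≠ 0 := C_ne_zero.mpr two_ne_zero
  have hdeg : (C (2 : k) * u * h).natDegree = 0 := by
    have := natDegree_eq_zero_of_isUnit hu
    rwa [← C_1, natDegree_C_add, ← C_ofNat] at this
  rw [natDegree_mul (mul_ne_zero h2 hu0) hh, natDegree_mul h2 hu0] at hdeg
  omega

/-- No squares in the adjusted critical orbit of `x² + f`: for `f ∈ k[t]` non-constant
(char k = 0), `φ_f^n(0)` is not a square in `k[t]` for any `n ≥ 2`. -/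
theorem orbit_not_square (k : Type*) [Field k] [CharZero k] (f : Polynomial k)
    (hf : f.natDegree ≠ 0) :
    ∀ n : ℕ, 2 ≤ n → ¬ ∃ g : Polynomial k, g ^ 2 = (fun a => a ^ 2 + f)^[n] 0 := by
  rintro n hn ⟨g, hg⟩
  obtain ⟨m, rfl⟩ := Nat.exists_eq_add_of_le' hn
  obtain ⟨h, hh, hm⟩ := exists_iterate_sq_add_eq_mul
    (fun hu => hf (natDegree_eq_zero_of_isUnit hu)) m
  rw [Function.iterate_succ_apply', hm] at hg
  obtain ⟨u, hu⟩ : ∃ u, u = g - f * h := ⟨_, rfl⟩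
  obtain ⟨v, hv⟩ : ∃ v, v = g + f * h := ⟨_, rfl⟩
  have huv : u * v = f := by
    rw [hu, hv]
    linear_combination hg
  have hf0 : f ≠ 0 := by
    rintro rfl
    simp at hf
  have hv0 : v ≠ 0 := right_ne_zero_of_mul (huv ▸ hf0)
  have hdiff : v - u = 2 * (u * v) * h := by
    rw [huv, hu, hv]
    ring
  have hprod : (1 + 2 * v * h) * (1 + 2 * u * -h) = 1 := by
    linear_combination 2 * h * hdiff
  have hv_deg := natDegree_eq_zero_of_isUnit_one_add_two_mul hh (.of_mul_eq_one _ hprod)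
  have hu_deg := natDegree_eq_zero_of_isUnit_one_add_two_mul (neg_ne_zero.mpr hh)
    (.of_mul_eq_one _ ((mul_comm _ _).trans hprod))
  apply hf
  rw [← huv, natDegree_mul (left_ne_zero_of_mul (huv ▸ hf0)) hv0, hu_deg, hv_deg]
end

section
/- Let k be a field of characteristic zero, K = k(t), and let γ, c ∈ k[t] with deg γ ≠ deg c and φ(x) = (x−γ)² + c. Assume c·φ(c) ≠ 0, that −φ(γ) is not a square in k[t], and that φ^m(γ) is not a square in k[t] for every 2 ≤ m ≤ 8. Then φ is stable, i.e. φ^n is irreducible over K for every n ≥ 1. -/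
open Polynomial

universe u

namespace Polynomial

section Field

variable {K : Type u} [Field K]

theorem irreducible_comp_X_add_C {f : K[X]} (hf : Irreducible f) (a : K) :
    Irreducible (f.comp (X + C a)) :=
  (MulEquiv.irreducible_iff (taylorEquiv a) (x := f)).2 hf

/-- If the norm `(-1) ^ deg f * f(0)` of a root of `f` is not a square, then `f(x²)` inherits
irreducibility from `f`. -/
theorem irreducible_comp_X_sq {f : K[X]} (hfm : f.Monic) (hf : Irreducible f)
    (hsq : ¬ IsSquare ((-1) ^ f.natDegree * f.coeff 0)) : Irreducible (f.comp (X ^ 2)) := by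
  refine irreducible_comp hfm (monic_X_pow 2) hf fun E _ _ x hx ↦ ?_
  rw [Polynomial.map_pow, map_X]
  have hint : IsIntegral K x := not_not.mp fun h ↦
    hfm.ne_zero (hx.symm.trans (minpoly.eq_zero h))
  refine X_pow_sub_C_irreducible_of_prime Nat.prime_two fun b hb ↦ hsq ?_
  refine ⟨Algebra.norm K b, ?_⟩
  rw [← sq, ← map_pow, hb, ← IntermediateField.adjoin.powerBasis_gen hint,
    Algebra.PowerBasis.norm_gen_eq_coeff_zero_minpoly]
  simp [IntermediateField.minpoly_gen, hx]

/-- Composing with a quadratic polynomial `(x - γ)² + c` preserves irreducibility as soon as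
`(-1) ^ deg f * f(c)` is not a square. -/
theorem irreducible_comp_quadratic {f : K[X]} (hfm : f.Monic) (hf : Irreducible f) (γ c : K)
    (hsq : ¬ IsSquare ((-1) ^ f.natDegree * f.eval c)) :
    Irreducible (f.comp ((X - C γ) ^ 2 + C c)) := by
  have h := irreducible_comp_X_sq (hfm.comp_X_add_C c) (irreducible_comp_X_add_C hf c)
    (by simpa [natDegree_comp, coeff_zero_eq_eval_zero] using hsq)
  simpa [comp_assoc, sub_eq_add_neg] using irreducible_comp_X_add_C h (-γ)

end Field

section Domain

variable {R : Type*} [CommRing R] [IsDomain R]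

theorem natDegree_le_of_isSquare_sq_add (h2 : (2 : R) ≠ 0) {e c : R[X]} (hc : c ≠ 0)
    (h : IsSquare (e ^ 2 + c)) : e.natDegree ≤ c.natDegree := by
  obtain ⟨d, hd⟩ := h
  have hfac : (d - e) * (d + e) = c := by linear_combination -hd
  have hmul := natDegree_mul (left_ne_zero_of_mul (hfac.symm ▸ hc))
    (right_ne_zero_of_mul (hfac.symm ▸ hc))
  rw [hfac] at hmul
  have he : C 2 * e = (d + e) - (d - e) := by rw [C_ofNat]; ring
  have hle := natDegree_sub_le (d + e) (d - e)
  rw [← he, natDegree_C_mul h2] at hle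
  exact hle.trans (max_le (by omega) (by omega))

theorem natDegree_sq_add {e c : R[X]} (h : c.natDegree < 2 * e.natDegree) :
    (e ^ 2 + c).natDegree = 2 * e.natDegree := by
  rw [natDegree_add_eq_left_of_natDegree_lt (by rwa [natDegree_pow]), natDegree_pow]

theorem lt_natDegree_iterate_quadratic {γ c : R[X]} (hdeg : γ.natDegree ≠ c.natDegree) (m : ℕ) :
    max γ.natDegree c.natDegree < ((fun a ↦ (a - γ) ^ 2 + c)^[m + 2] γ).natDegree := by
  induction m with
  | zero =>
    have h : (c - γ).natDegree = max γ.natDegree c.natDegree := by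
      rcases hdeg.lt_or_gt with h | h
      · rw [natDegree_sub_eq_left_of_natDegree_lt h, max_eq_right h.le]
      · rw [natDegree_sub_eq_right_of_natDegree_lt h, max_eq_left h.le]
    have : (fun a ↦ (a - γ) ^ 2 + c)^[0 + 2] γ = (c - γ) ^ 2 + c := by simp
    rw [this, natDegree_sq_add] <;> omega
  | succ m ih =>
    rw [add_right_comm, Function.iterate_succ_apply']
    set b := (fun a ↦ (a - γ) ^ 2 + c)^[m + 2] γ
    have hb : (b - γ).natDegree = b.natDegree :=
      natDegree_sub_eq_left_of_natDegree_lt ((le_max_left _ _).trans_lt ih)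
    rw [natDegree_sq_add] <;> omega

theorem not_isSquare_iterate_quadratic (h2 : (2 : R) ≠ 0) {γ c : R[X]} (hc : c ≠ 0)
    (hdeg : γ.natDegree ≠ c.natDegree) (m : ℕ) :
    ¬ IsSquare ((fun a ↦ (a - γ) ^ 2 + c)^[m + 3] γ) := by
  intro h
  have hlt := lt_natDegree_iterate_quadratic hdeg m
  rw [Function.iterate_succ_apply'] at h
  have hle := natDegree_le_of_isSquare_sq_add h2 hc h
  rw [natDegree_sub_eq_left_of_natDegree_lt ((le_max_left _ _).trans_lt hlt)] at hle
  omega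

end Domain

section Iterate

variable {R : Type*} [CommRing R]

theorem eval_iterate_comp_X (φ : R[X]) (n : ℕ) (a : R) :
    ((fun p : R[X] ↦ p.comp φ)^[n] X).eval a = (fun b ↦ φ.eval b)^[n] a := by
  induction n generalizing a with
  | zero => simp
  | succ n ih => rw [Function.iterate_succ_apply', eval_comp, ih, Function.iterate_succ_apply]

theorem natDegree_iterate_comp_X [IsDomain R] (φ : R[X]) (n : ℕ) :
    ((fun p : R[X] ↦ p.comp φ)^[n] X).natDegree = φ.natDegree ^ n := by
  induction n with
  | zero => simp
  | succ n ih => rw [Function.iterate_succ_apply', natDegree_comp, ih, pow_succ]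

theorem Monic.iterate_comp_X {φ : R[X]} (hφ : φ.Monic) (hdeg : φ.natDegree ≠ 0) (n : ℕ) :
    ((fun p : R[X] ↦ p.comp φ)^[n] X).Monic := by
  induction n with
  | zero => exact monic_X
  | succ n ih => rw [Function.iterate_succ_apply']; exact ih.comp hφ hdeg

end Iterate

end Polynomial

theorem IsIntegrallyClosed.isSquare_of_isSquare_algebraMap {R K : Type*} [CommRing R] [IsDomain R]
    [IsIntegrallyClosed R] [Field K] [Algebra R K] [IsFractionRing R K] {a : R}
    (h : IsSquare (algebraMap R K a)) : IsSquare a := by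
  obtain ⟨d, hd⟩ := h
  rw [← sq] at hd
  obtain ⟨y, rfl⟩ := exists_algebraMap_eq_of_isIntegral_pow (R := R) two_pos
    (hd ▸ isIntegral_algebraMap)
  refine ⟨y, IsFractionRing.injective R K ?_⟩
  rw [hd, map_mul, sq]

/-- Proposition 1 part 1 (stability test, `h(γ) ≠ h(c)`): if `c·φ(c) ≠ 0`, and none of
`-φ(γ), φ²(γ), …, φ⁸(γ)` is a square in `k[t]`, then `φ = (x-γ)²+c` is stable over `k(t)`. -/
theorem stability_test_ne (k : Type*) [Field k] [CharZero k] (γ c : Polynomial k)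
    (hdeg : γ.natDegree ≠ c.natDegree)
    (hc : c * ((c - γ) ^ 2 + c) ≠ 0)
    (h1 : ¬ IsSquare (-((fun a => (a - γ) ^ 2 + c)^[1] γ)))
    (hm : ∀ m : ℕ, 2 ≤ m → m ≤ 8 → ¬ IsSquare ((fun a => (a - γ) ^ 2 + c)^[m] γ))
    (φ : Polynomial (RatFunc k))
    (hφ : φ = (X - C (algebraMap (Polynomial k) (RatFunc k) γ)) ^ 2
            + C (algebraMap (Polynomial k) (RatFunc k) c)) :
    ∀ n : ℕ, 1 ≤ n →
      Irreducible ((fun p => p.comp φ)^[n] (X : Polynomial (RatFunc k))) := by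
  have hc0 : c ≠ 0 := left_ne_zero_of_mul hc
  have hφdeg : φ.natDegree = 2 := by
    rw [hφ, natDegree_add_C, natDegree_pow, natDegree_X_sub_C]
  have hφm : φ.Monic := by
    rw [hφ]
    refine ((monic_X_sub_C _).pow 2).add_of_left (degree_C_le.trans_lt ?_)
    simp
  have hsq (n : ℕ) :
      ¬ IsSquare ((-1) ^ 2 ^ n * (fun a => (a - γ) ^ 2 + c)^[n + 1] γ) := by
    match n with
    | 0 => simpa using h1
    | 1 => simpa using hm 2 le_rfl (by norm_num)
    | n + 2 =>
      rw [(even_two.pow_of_ne_zero n.succ.succ_ne_zero).neg_one_pow, one_mul]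
      exact not_isSquare_iterate_quadratic two_ne_zero hc0 hdeg n
  have heval (n : ℕ) (a : k[X]) :
      (fun b ↦ φ.eval b)^[n] (algebraMap k[X] (RatFunc k) a) =
        algebraMap k[X] (RatFunc k) ((fun a => (a - γ) ^ 2 + c)^[n] a) :=
    (Function.Semiconj.iterate_right (f := algebraMap k[X] (RatFunc k))
      (fun a ↦ by simp [hφ]) n a).symm
  intro n _
  clear * - hφ hφm hφdeg hsq heval
  induction n with
  | zero => exact irreducible_X
  | succ n ih =>
    rw [Function.iterate_succ_apply']
    nth_rw 2 [hφ]
    refine irreducible_comp_quadratic (hφm.iterate_comp_X (by omega) n) ih _ _ fun h ↦ hsq n ?_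
    rw [natDegree_iterate_comp_X, hφdeg, eval_iterate_comp_X, heval] at h
    refine IsIntegrallyClosed.isSquare_of_isSquare_algebraMap (K := RatFunc k) ?_
    simpa using h
end
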